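/- arXiv:2312.17148 — 2 statements merged into one kernel-verified Lean document; each statement's English description precedes it below -/
import Mathlib

section
/- Σ_{m≥1} (−1)^m / m! · (x)_m (−s)_m / (1−s)_m = −Σ_{k≥1, n≥1} ζ({1}^{k−1}, \overline{n+1}) x^k s^n, i.e. the coefficient of x^k s^n in ₂F₁(x,−s;1−s;−1) − 1 equals −ζ({1}^{k−1}, \overline{n+1}), where (q)_m is the Pochhammer symbol. -/
open scoped Nat

/-- The alternating multiple zeta value `ζ({1}^d, overline{n+1})
= ∑_{0<n₁<⋯<n_{d+1}} (-1)^{n_{d+1}} / (n₁⋯n_d · n_{d+1}^{n+1})`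
(depth `d+1`, with `d` leading ones and final entry `n+1` carrying the sign `-1`). -/
noncomputable def azeta (d n : ℕ) : ℝ :=
  ∑' f : {f : Fin (d + 1) → ℕ // StrictMono f ∧ 0 < f 0},
    (-1 : ℝ) ^ (f.1 (Fin.last d)) /
      ((∏ i : Fin d, (f.1 i.castSucc : ℝ)) * (f.1 (Fin.last d) : ℝ) ^ (n + 1))

/-- The elementary symmetric polynomial of degree `d` in `1, 1/2, …, 1/m`. -/
noncomputable def esymmInv (d m : ℕ) : ℝ :=
  ∑ T ∈ (Finset.Icc 1 m).powersetCard d, ∏ j ∈ T, (j : ℝ)⁻¹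

/-- The product `∏_{1 ≤ j ≤ m} (1 + y / j)`. -/
noncomputable def prodOneAddDiv (y : ℝ) (m : ℕ) : ℝ :=
  ∏ j ∈ Finset.Icc 1 m, (1 + y / j)

lemma esymmInv_nonneg (d m : ℕ) : 0 ≤ esymmInv d m :=
  Finset.sum_nonneg fun _ _ => Finset.prod_nonneg fun _ _ => by positivity

lemma prodOneAddDiv_nonneg {y : ℝ} (hy : 0 ≤ y) (m : ℕ) : 0 ≤ prodOneAddDiv y m :=
  Finset.prod_nonneg fun _ _ => by positivity

lemma prodOneAddDiv_succ (y : ℝ) (m : ℕ) :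
    prodOneAddDiv y (m + 1) = prodOneAddDiv y m * (1 + y / (m + 1)) := by
  unfold prodOneAddDiv
  rw [Finset.prod_Icc_succ_top (by omega)]
  push_cast
  rfl

lemma hasSum_esymmInv_mul_pow (y : ℝ) (m : ℕ) :
    HasSum (fun d => esymmInv d m * y ^ d) (prodOneAddDiv y m) := by
  have h : prodOneAddDiv y m = ∑ d ∈ Finset.range (m + 1), esymmInv d m * y ^ d := by
    unfold prodOneAddDiv esymmInv
    rw [Finset.prod_one_add, Finset.sum_powerset]
    simp only [Nat.card_Icc, Nat.add_sub_cancel]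
    refine Finset.sum_congr rfl fun d _ => ?_
    rw [Finset.sum_mul]
    refine Finset.sum_congr rfl fun T hT => ?_
    rw [← (Finset.mem_powersetCard.1 hT).2, ← Finset.prod_const, ← Finset.prod_mul_distrib]
    exact Finset.prod_congr rfl fun j _ => by ring
  rw [h]
  apply hasSum_sum_of_ne_finset_zero
  intro d hd
  have hlt : (Finset.Icc 1 m).card < d := by
    rw [Nat.card_Icc, Nat.add_sub_cancel]
    by_contra hle
    exact hd (Finset.mem_range.2 (by omega))
  rw [esymmInv, Finset.powersetCard_eq_empty.2 hlt, Finset.sum_empty, zero_mul]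

/-- The telescoping `P_m / (m + 1) - P_{m + 1} / (m + 2) = (1 - y) P_m / ((m + 1) (m + 2))`
bounds the partial sums. -/
lemma summable_prodOneAddDiv_div_sq {y : ℝ} (hy : 0 ≤ y) (hy1 : y < 1) :
    Summable fun m : ℕ => prodOneAddDiv y m / ((m : ℝ) + 1) ^ 2 := by
  have htel (N : ℕ) : ∑ m ∈ Finset.range N, prodOneAddDiv y m / (((m : ℝ) + 1) * (m + 2))
      = (1 - prodOneAddDiv y N / (N + 1)) / (1 - y) := by
    have : 1 - y ≠ 0 := by linarith
    induction N with
    | zero => simp [prodOneAddDiv]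
    | succ N ih =>
      rw [Finset.sum_range_succ, ih, prodOneAddDiv_succ]
      have h1 : (N : ℝ) + 1 ≠ 0 := by positivity
      have h2 : (N : ℝ) + 2 ≠ 0 := by positivity
      have h3 : ((N + 1 : ℕ) : ℝ) + 1 = N + 2 := by push_cast; ring
      rw [h3]
      field_simp
      ring
  have hs : Summable fun m : ℕ => prodOneAddDiv y m / (((m : ℝ) + 1) * (m + 2)) := by
    refine summable_of_sum_range_le (c := 1 / (1 - y))
      (fun m => div_nonneg (prodOneAddDiv_nonneg hy m) (by positivity)) fun N => ?_
    rw [htel]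
    have : 0 ≤ prodOneAddDiv y N / (N + 1) :=
      div_nonneg (prodOneAddDiv_nonneg hy N) (by positivity)
    have : 0 < 1 - y := by linarith
    gcongr
    linarith
  refine (hs.mul_left 2).of_nonneg_of_le
    (fun m => div_nonneg (prodOneAddDiv_nonneg hy m) (by positivity)) fun m => ?_
  have := prodOneAddDiv_nonneg hy m
  rw [← mul_div_assoc, div_le_div_iff₀ (by positivity) (by positivity)]
  have : 0 ≤ prodOneAddDiv y m * (((m : ℝ) + 1) * m) := by positivity
  nlinarith

lemma summable_esymmInv_div_sq (d : ℕ) :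
    Summable fun m : ℕ => esymmInv d m / ((m : ℝ) + 1) ^ 2 := by
  refine ((summable_prodOneAddDiv_div_sq (y := 1 / 2) (by norm_num) (by norm_num)).mul_left
    (2 ^ d)).of_nonneg_of_le
    (fun m => div_nonneg (esymmInv_nonneg d m) (by positivity)) fun m => ?_
  have h := le_hasSum (hasSum_esymmInv_mul_pow (1 / 2) m) d
    fun j _ => mul_nonneg (esymmInv_nonneg j m) (by positivity)
  rw [← mul_div_assoc]
  gcongr
  calc esymmInv d m = 2 ^ d * (esymmInv d m * (1 / 2) ^ d) := by
        rw [mul_left_comm, ← mul_pow]; norm_num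
    _ ≤ _ := by gcongr

/-- The strictly increasing tuple listing `T ⊆ {1, …, m}` followed by `m + 1`. -/
noncomputable def snocTuple (d : ℕ)
    (p : Σ m : ℕ, {T : Finset ℕ // T ∈ (Finset.Icc 1 m).powersetCard d}) :
    {f : Fin (d + 1) → ℕ // StrictMono f ∧ 0 < f 0} :=
  ⟨Fin.snoc (α := fun _ => ℕ)
      (p.2.1.orderEmbOfFin (Finset.mem_powersetCard.1 p.2.2).2) (p.1 + 1), by
    obtain ⟨m, T, hT⟩ := p
    obtain ⟨hT1, hT2⟩ := Finset.mem_powersetCard.1 hT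
    have hmem (i : Fin d) := Finset.mem_Icc.1 (hT1 (T.orderEmbOfFin_mem hT2 i))
    refine ⟨fun i j hij => ?_, ?_⟩
    · induction i using Fin.lastCases with
      | last => exact absurd hij (not_lt.2 (Fin.le_last j))
      | cast i =>
        induction j using Fin.lastCases with
        | last =>
          simp only [Fin.snoc_castSucc, Fin.snoc_last]
          exact Nat.lt_succ_of_le (hmem i).2
        | cast j =>
          simp only [Fin.snoc_castSucc]
          exact (T.orderEmbOfFin hT2).strictMono (by simpa using hij)
    · generalize (0 : Fin (d + 1)) = i
      induction i using Fin.lastCases with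
      | last => simp
      | cast i =>
        simp only [Fin.snoc_castSucc]
        exact (hmem i).1⟩

lemma snocTuple_last (d : ℕ)
    (p : Σ m : ℕ, {T : Finset ℕ // T ∈ (Finset.Icc 1 m).powersetCard d}) :
    (snocTuple d p).1 (Fin.last d) = p.1 + 1 := by
  simp [snocTuple]

lemma snocTuple_castSucc (d : ℕ)
    (p : Σ m : ℕ, {T : Finset ℕ // T ∈ (Finset.Icc 1 m).powersetCard d}) (i : Fin d) :
    (snocTuple d p).1 i.castSucc
      = p.2.1.orderEmbOfFin (Finset.mem_powersetCard.1 p.2.2).2 i := by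
  simp [snocTuple]

lemma image_snocTuple_castSucc (d : ℕ)
    (p : Σ m : ℕ, {T : Finset ℕ // T ∈ (Finset.Icc 1 m).powersetCard d}) :
    Finset.univ.image (fun i : Fin d => (snocTuple d p).1 i.castSucc) = p.2.1 := by
  simp only [snocTuple_castSucc]
  exact Finset.image_orderEmbOfFin_univ _ _

lemma snocTuple_bijective (d : ℕ) : Function.Bijective (snocTuple d) := by
  constructor
  · intro p q h
    have h1 : p.1 = q.1 := by
      simpa [snocTuple_last] using congrArg (fun f => f.1 (Fin.last d)) h
    have h2 : p.2.1 = q.2.1 := by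
      rw [← image_snocTuple_castSucc d p, h, image_snocTuple_castSucc]
    obtain ⟨m, T, hT⟩ := p
    obtain ⟨n, U, hU⟩ := q
    dsimp only at h1 h2
    subst h1 h2
    rfl
  · rintro ⟨f, hf, hf0⟩
    have hinj : Function.Injective fun i : Fin d => f i.castSucc :=
      hf.injective.comp (Fin.castSucc_injective d)
    have hlast : 0 < f (Fin.last d) := hf0.trans_le (hf.monotone (Fin.zero_le _))
    refine ⟨⟨f (Fin.last d) - 1, Finset.univ.image fun i : Fin d => f i.castSucc,
      Finset.mem_powersetCard.2 ⟨fun a ha => ?_, ?_⟩⟩, ?_⟩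
    · obtain ⟨i, -, rfl⟩ := Finset.mem_image.1 ha
      have h1 := hf (Fin.castSucc_lt_last i)
      have h2 := hf.monotone (Fin.zero_le i.castSucc)
      exact Finset.mem_Icc.2 ⟨by omega, by omega⟩
    · rw [Finset.card_image_of_injective _ hinj, Finset.card_fin]
    · refine Subtype.ext (funext fun i => ?_)
      induction i using Fin.lastCases with
      | last =>
        rw [snocTuple_last]
        exact Nat.sub_add_cancel hlast
      | cast i =>
        rw [snocTuple_castSucc]
        exact (congrFun (Finset.orderEmbOfFin_unique _
          (fun i => Finset.mem_image_of_mem _ (Finset.mem_univ i))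
          (hf.comp Fin.strictMono_castSucc)) i).symm

lemma azeta_eq_tsum (d n : ℕ) :
    azeta d (n + 1)
      = ∑' m : ℕ, (-1 : ℝ) ^ (m + 1) * (esymmInv d m / ((m : ℝ) + 1) ^ (n + 2)) := by
  have hterm (p : Σ m : ℕ, {T : Finset ℕ // T ∈ (Finset.Icc 1 m).powersetCard d}) :
      (-1 : ℝ) ^ ((snocTuple d p).1 (Fin.last d)) /
        ((∏ i : Fin d, ((snocTuple d p).1 i.castSucc : ℝ))
          * ((snocTuple d p).1 (Fin.last d) : ℝ) ^ (n + 1 + 1))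
        = (-1 : ℝ) ^ (p.1 + 1) / ((p.1 : ℝ) + 1) ^ (n + 2) * ∏ j ∈ p.2.1, (j : ℝ)⁻¹ := by
    have hprod : ∏ i : Fin d, ((snocTuple d p).1 i.castSucc : ℝ) = ∏ j ∈ p.2.1, (j : ℝ) := by
      conv_rhs => rw [← image_snocTuple_castSucc d p]
      rw [Finset.prod_image]
      exact ((snocTuple d p).2.1.injective.comp (Fin.castSucc_injective d)).injOn
    rw [hprod, snocTuple_last, Finset.prod_inv_distrib]
    push_cast
    rw [div_mul_eq_div_div_swap, div_eq_mul_inv]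
  have hfib (c : ℕ → ℝ) (m : ℕ) :
      HasSum (fun T : {T : Finset ℕ // T ∈ (Finset.Icc 1 m).powersetCard d} =>
        c m * ∏ j ∈ T.1, (j : ℝ)⁻¹) (c m * esymmInv d m) := by
    rw [esymmInv, ← Finset.sum_coe_sort, Finset.mul_sum]
    exact hasSum_fintype _
  unfold azeta
  rw [← (Equiv.ofBijective _ (snocTuple_bijective d)).tsum_eq]
  simp only [Equiv.ofBijective_apply, hterm]
  have hnorm : Summable fun p : Σ m : ℕ, {T : Finset ℕ // T ∈ (Finset.Icc 1 m).powersetCard d} =>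
      1 / ((p.1 : ℝ) + 1) ^ (n + 2) * ∏ j ∈ p.2.1, (j : ℝ)⁻¹ := by
    rw [summable_sigma_of_nonneg fun p =>
      mul_nonneg (by positivity) (Finset.prod_nonneg fun _ _ => by positivity)]
    refine ⟨fun m => (hfib (fun m => 1 / ((m : ℝ) + 1) ^ (n + 2)) m).summable, ?_⟩
    simp only [fun m => (hfib (fun m => 1 / ((m : ℝ) + 1) ^ (n + 2)) m).tsum_eq]
    refine (summable_esymmInv_div_sq d).of_nonneg_of_le
      (fun m => mul_nonneg (by positivity) (esymmInv_nonneg d m)) fun m => ?_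
    have := esymmInv_nonneg d m
    rw [one_div_mul_eq_div]
    gcongr
    · linarith [m.cast_nonneg (α := ℝ)]
    · omega
  have hsum : Summable fun p : Σ m : ℕ, {T : Finset ℕ // T ∈ (Finset.Icc 1 m).powersetCard d} =>
      (-1 : ℝ) ^ (p.1 + 1) / ((p.1 : ℝ) + 1) ^ (n + 2) * ∏ j ∈ p.2.1, (j : ℝ)⁻¹ := by
    refine hnorm.of_norm_bounded fun p => le_of_eq ?_
    rw [norm_mul, norm_div, norm_pow, norm_neg, norm_one, one_pow, Real.norm_of_nonneg,
      Real.norm_of_nonneg (Finset.prod_nonneg fun _ _ => by positivity)]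
    positivity
  rw [hsum.tsum_sigma]
  refine tsum_congr fun m => ?_
  rw [(hfib (fun m => (-1 : ℝ) ^ (m + 1) / ((m : ℝ) + 1) ^ (n + 2)) m).tsum_eq]
  ring

lemma hasSum_esymmInv_mul_pow_mul_pow (x : ℝ) {s : ℝ} (hs : |s| < 1) (m : ℕ) :
    HasSum (fun p : ℕ × ℕ =>
        esymmInv p.1 m / ((m : ℝ) + 1) ^ (p.2 + 2) * x ^ (p.1 + 1) * s ^ (p.2 + 1))
      (x / (m + 1) * prodOneAddDiv x m * (s / (m + 1 - s))) := by
  have hm : (0 : ℝ) < m + 1 := by positivity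
  have hlt : |s / (m + 1)| < 1 := by
    rw [abs_div, abs_of_pos hm, div_lt_one hm]
    linarith [m.cast_nonneg (α := ℝ)]
  have h1 := (hasSum_esymmInv_mul_pow x m).mul_left (x / (m + 1))
  have h2 := (hasSum_geometric_of_abs_lt_one hlt).mul_left (s / (m + 1))
  have h := h1.mul h2 (summable_mul_of_summable_norm h1.summable.norm h2.summable.norm)
  have hval : s / (m + 1 - s) = s / (m + 1) * (1 - s / (m + 1))⁻¹ := by
    rw [one_sub_div hm.ne', inv_div]
    field_simp
  rw [hval]
  refine (congrArg (HasSum · _) (funext fun p => ?_)).mpr h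
  rw [div_pow]
  field_simp
  ring

lemma summable_esymmInv_mul_pow_mul_pow {x s : ℝ} (hx : |x| < 1) (hs : |s| < 1) :
    Summable fun q : ℕ × (ℕ × ℕ) => (-1 : ℝ) ^ (q.1 + 1) *
      (esymmInv q.2.1 q.1 / ((q.1 : ℝ) + 1) ^ (q.2.2 + 2)
        * x ^ (q.2.1 + 1) * s ^ (q.2.2 + 1)) := by
  have hnonneg (q : ℕ × (ℕ × ℕ)) : 0 ≤ esymmInv q.2.1 q.1 / ((q.1 : ℝ) + 1) ^ (q.2.2 + 2)
      * |x| ^ (q.2.1 + 1) * |s| ^ (q.2.2 + 1) := by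
    have := esymmInv_nonneg q.2.1 q.1
    positivity
  have habs : Summable fun q : ℕ × (ℕ × ℕ) =>
      esymmInv q.2.1 q.1 / ((q.1 : ℝ) + 1) ^ (q.2.2 + 2)
        * |x| ^ (q.2.1 + 1) * |s| ^ (q.2.2 + 1) := by
    have hfib := hasSum_esymmInv_mul_pow_mul_pow |x| ((abs_abs s).trans_lt hs)
    rw [summable_prod_of_nonneg hnonneg]
    refine ⟨fun m => (hfib m).summable, ?_⟩
    simp only [fun m => (hfib m).tsum_eq]
    have h1s : 0 < 1 - |s| := by linarith
    refine ((summable_prodOneAddDiv_div_sq (abs_nonneg x) hx).mul_left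
      (1 / (1 - |s|))).of_nonneg_of_le (fun m => ?_) fun m => ?_
    · exact (hfib m).nonneg fun p => hnonneg (m, p)
    have hP := prodOneAddDiv_nonneg (abs_nonneg x) m
    have hle : (m + 1) * (1 - |s|) ≤ (m : ℝ) + 1 - |s| := by
      nlinarith [mul_nonneg (m.cast_nonneg (α := ℝ)) (abs_nonneg s)]
    have hpos : 0 < (m : ℝ) + 1 - |s| := by linarith [m.cast_nonneg (α := ℝ)]
    calc |x| / (m + 1) * prodOneAddDiv |x| m * (|s| / (m + 1 - |s|))
        ≤ 1 / (m + 1) * prodOneAddDiv |x| m * (1 / ((m + 1) * (1 - |s|))) := by gcongr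
      _ = _ := by field_simp
  refine habs.of_norm_bounded fun q => le_of_eq ?_
  rw [norm_mul, norm_pow, norm_neg, norm_one, one_pow, one_mul, norm_mul, norm_mul, norm_pow,
    norm_pow, Real.norm_eq_abs x, Real.norm_eq_abs s, Real.norm_of_nonneg]
  exact div_nonneg (esymmInv_nonneg _ _) (by positivity)

lemma ascPochhammer_eval_div_factorial (x : ℝ) (m : ℕ) :
    (ascPochhammer ℝ (m + 1)).eval x / ((m + 1)! : ℝ) = x / (m + 1) * prodOneAddDiv x m := by
  induction m with
  | zero => simp [prodOneAddDiv]
  | succ m ih =>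
    rw [ascPochhammer_succ_eval, Nat.factorial_succ, prodOneAddDiv_succ]
    push_cast
    rw [mul_comm (((m : ℝ) + 1 + 1)), mul_div_mul_comm, ih]
    field_simp
    ring

lemma ascPochhammer_eval_neg_div {s : ℝ} (hs : s < 1) (m : ℕ) :
    (ascPochhammer ℝ (m + 1)).eval (-s) / (ascPochhammer ℝ (m + 1)).eval (1 - s)
      = -(s / (m + 1 - s)) := by
  have hpos := ascPochhammer_pos m (1 - s) (by linarith)
  rw [ascPochhammer_succ_eval m (1 - s), ascPochhammer_succ_left]
  simp only [Polynomial.eval_mul, Polynomial.eval_X, Polynomial.eval_comp, Polynomial.eval_add,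
    Polynomial.eval_one]
  rw [neg_add_eq_sub s 1, mul_comm (-s), mul_div_mul_left _ _ hpos.ne', neg_div,
    sub_add_eq_add_sub, add_comm (1 : ℝ)]

/-- `∑_{m≥1} (-1)^m/m! · (x)ₘ(-s)ₘ/(1-s)ₘ = −∑_{k,n≥1} ζ({1}^{k-1}, overline{n+1}) x^k s^n`. -/
theorem pochhammer_series_eq_neg_azeta_series (x s : ℝ) (hx : |x| < 1) (hs : |s| < 1) :
    ∑' m : ℕ, (-1 : ℝ) ^ (m + 1) / ((m + 1)! : ℝ)
        * ((ascPochhammer ℝ (m + 1)).eval x * (ascPochhammer ℝ (m + 1)).eval (-s)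
            / (ascPochhammer ℝ (m + 1)).eval (1 - s))
      = - ∑' p : ℕ × ℕ, azeta p.1 (p.2 + 1) * x ^ (p.1 + 1) * s ^ (p.2 + 1) := by
  have hterm (m : ℕ) : (-1 : ℝ) ^ (m + 1) / ((m + 1)! : ℝ)
        * ((ascPochhammer ℝ (m + 1)).eval x * (ascPochhammer ℝ (m + 1)).eval (-s)
            / (ascPochhammer ℝ (m + 1)).eval (1 - s))
      = -∑' p : ℕ × ℕ, (-1 : ℝ) ^ (m + 1) *
        (esymmInv p.1 m / ((m : ℝ) + 1) ^ (p.2 + 2) * x ^ (p.1 + 1) * s ^ (p.2 + 1)) := by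
    rw [tsum_mul_left, (hasSum_esymmInv_mul_pow_mul_pow x hs m).tsum_eq, mul_div_assoc,
      ascPochhammer_eval_neg_div (lt_of_abs_lt hs), ← ascPochhammer_eval_div_factorial]
    ring
  simp only [hterm]
  rw [tsum_neg, ← Summable.tsum_comm (f := fun (m : ℕ) (p : ℕ × ℕ) => (-1 : ℝ) ^ (m + 1) *
    (esymmInv p.1 m / ((m : ℝ) + 1) ^ (p.2 + 2) * x ^ (p.1 + 1) * s ^ (p.2 + 1)))
    (summable_esymmInv_mul_pow_mul_pow hx hs)]
  congr 1
  refine tsum_congr fun p => ?_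
  rw [azeta_eq_tsum, mul_assoc, ← tsum_mul_right]
  exact tsum_congr fun m => by ring
end

section
/- Depth-reduction for ζ(1,1,\overline{2m}): as an identity of convergent power series in s for |s| < 1, Σ_{m≥1} ( ζ(1,1,\overline{2m}) − ((2m−1)/2)·ζ(1,\overline{2m+1}) )·s^{2m−1} = −1/(4s³) + π csc(πs)/(4s²) + π³ csc(πs)/24 + π csc(πs)(ψ(1−s)+γ)/(4s) − (1/4)π csc(πs)(ψ(1−s)+γ)(ψ(1+s)+γ) − π csc(πs)(ψ(1+s)+γ)/(4s), where ψ is the digamma function and γ is the Euler–Mascheroni constant. -/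
open Real

/-- The digamma function `ψ(t) = Γ'(t)/Γ(t) = (log Γ)'(t)`. -/
noncomputable def digamma (t : ℝ) : ℝ := deriv (fun u : ℝ => Real.log (Real.Gamma u)) t

open Filter Finset Topology

/-- The harmonic number `∑_{i=1}^n 1/i`, as a real number. -/
noncomputable def hsum (n : ℕ) : ℝ := ∑ i ∈ range n, 1 / ((i : ℝ) + 1)

/-- The double harmonic sum `∑_{1 ≤ j < k ≤ n} 1/(j k)`. -/
noncomputable def esum (n : ℕ) : ℝ := ∑ k ∈ range n, hsum k / ((k : ℝ) + 1)

lemma hsum_succ (n : ℕ) : hsum (n + 1) = hsum n + 1 / ((n : ℝ) + 1) := by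
  simp [hsum, sum_range_succ]

lemma hsum_nonneg (n : ℕ) : 0 ≤ hsum n := sum_nonneg fun _ _ => by positivity

lemma hsum_mono {m n : ℕ} (h : m ≤ n) : hsum m ≤ hsum n :=
  sum_le_sum_of_subset_of_nonneg (by simpa using h) fun _ _ _ => by positivity

lemma two_mul_esum (n : ℕ) :
    2 * esum n = hsum n ^ 2 - ∑ i ∈ range n, 1 / ((i : ℝ) + 1) ^ 2 := by
  induction n with
  | zero => simp [esum, hsum]
  | succ n ih =>
    have h : esum (n + 1) = esum n + hsum n / ((n : ℝ) + 1) := by simp [esum, sum_range_succ]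
    rw [h, hsum_succ, sum_range_succ, mul_add, ih]
    field_simp
    ring

lemma esum_nonneg (n : ℕ) : 0 ≤ esum n :=
  sum_nonneg fun k _ => div_nonneg (hsum_nonneg k) (by positivity)

lemma esum_le (n : ℕ) : esum n ≤ hsum n ^ 2 := by
  have h := two_mul_esum n
  have h1 : 0 ≤ ∑ i ∈ range n, 1 / ((i : ℝ) + 1) ^ 2 := sum_nonneg fun _ _ => by positivity
  nlinarith [esum_nonneg n]

lemma hsum_eq_harmonic (n : ℕ) : hsum n = (harmonic n : ℝ) := by
  simp [hsum, harmonic]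

lemma hsum_le_rpow (n : ℕ) : hsum n ≤ 5 * ((n : ℝ) + 1) ^ (1 / 4 : ℝ) := by
  have h2 : Real.log ((n : ℝ) + 1) ≤ ((n : ℝ) + 1) ^ (1 / 4 : ℝ) / (1 / 4 : ℝ) :=
    Real.log_le_rpow_div (by positivity) (by norm_num)
  have h3 : (1 : ℝ) ≤ ((n : ℝ) + 1) ^ (1 / 4 : ℝ) :=
    Real.one_le_rpow (by linarith [n.cast_nonneg (α := ℝ)]) (by norm_num)
  have h1 := harmonic_le_one_add_log (n + 1)
  rw [← hsum_eq_harmonic] at h1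
  push_cast at h1
  linarith [hsum_mono n.le_succ]

lemma summable_one_div_sq : Summable fun n : ℕ => 1 / ((n : ℝ) + 1) ^ 2 := by
  have h := (summable_nat_add_iff 1).2 (Real.summable_one_div_nat_pow.2 one_lt_two)
  simpa using h

lemma summable_hsum_sq : Summable fun n : ℕ => hsum n ^ 2 / ((n : ℝ) + 1) ^ 2 := by
  have h := (Real.summable_one_div_nat_add_rpow 1 (3 / 2)).2 (by norm_num)
  refine Summable.of_nonneg_of_le (fun n => by positivity) (fun n => ?_) (h.mul_left 25)
  have hp : (0 : ℝ) < (n : ℝ) + 1 := by positivity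
  rw [abs_of_pos hp, mul_one_div, div_le_div_iff₀ (by positivity) (by positivity)]
  have h2 : hsum n ^ 2 ≤ 25 * ((n : ℝ) + 1) ^ (1 / 2 : ℝ) := by
    calc hsum n ^ 2 ≤ (5 * ((n : ℝ) + 1) ^ (1 / 4 : ℝ)) ^ 2 :=
          pow_le_pow_left₀ (hsum_nonneg n) (hsum_le_rpow n) 2
      _ = 25 * ((n : ℝ) + 1) ^ (1 / 2 : ℝ) := by
          rw [mul_pow, ← Real.rpow_mul_natCast hp.le]; norm_num
  calc hsum n ^ 2 * ((n : ℝ) + 1) ^ (3 / 2 : ℝ)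
      ≤ (25 * ((n : ℝ) + 1) ^ (1 / 2 : ℝ)) * ((n : ℝ) + 1) ^ (3 / 2 : ℝ) := by gcongr
    _ = 25 * ((n : ℝ) + 1) ^ 2 := by
        rw [mul_assoc, ← Real.rpow_add hp]; norm_num

lemma summable_esum : Summable fun n : ℕ => esum n / ((n : ℝ) + 1) ^ 2 :=
  summable_hsum_sq.of_nonneg_of_le (fun n => div_nonneg (esum_nonneg n) (by positivity))
    fun n => by gcongr; exact esum_le n

lemma summable_hsum : Summable fun n : ℕ => hsum n / ((n : ℝ) + 1) ^ 2 := by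
  refine (summable_one_div_sq.add summable_hsum_sq).of_nonneg_of_le
    (fun n => div_nonneg (hsum_nonneg n) (by positivity)) fun n => ?_
  rw [← add_div]
  gcongr
  nlinarith [sq_nonneg (hsum n - 1)]

lemma summable_hsum_succ : Summable fun n : ℕ => hsum (n + 1) / ((n : ℝ) + 1) ^ 2 := by
  refine (summable_hsum.add summable_one_div_sq).of_nonneg_of_le
    (fun n => div_nonneg (hsum_nonneg _) (by positivity)) fun n => ?_
  rw [← add_div, hsum_succ]
  gcongr
  rw [div_le_one (by positivity)]
  linarith [n.cast_nonneg (α := ℝ)]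

/-- Partial sums of `u j - u (j + n)` telescope when `u → 0`. -/
lemma tendsto_sum_sub_shift {u : ℕ → ℝ} (hu : Tendsto u atTop (𝓝 0)) (n : ℕ) :
    Tendsto (fun J => ∑ j ∈ range J, (u j - u (j + n))) atTop (𝓝 (∑ i ∈ range n, u i)) := by
  have h : ∀ J, ∑ j ∈ range J, (u j - u (j + n))
      = ∑ i ∈ range n, u i - ∑ i ∈ range n, u (J + i) := fun J => by
    have h1 := sum_range_add u J n
    have h2 := sum_range_add u n J
    rw [add_comm n J, h1] at h2
    simp only [sum_sub_distrib, add_comm _ n]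
    linarith
  simp only [h]
  have h3 : Tendsto (fun J => ∑ i ∈ range n, u (J + i)) atTop (𝓝 (∑ i ∈ range n, (0 : ℝ))) :=
    tendsto_finsetSum _ fun i _ => hu.comp (tendsto_add_atTop_nat i)
  simpa using tendsto_const_nhds.sub h3

lemma tsum_eq_of_sub_shift {f u : ℕ → ℝ} {c : ℝ} {n : ℕ} (hf : Summable f)
    (hu : Tendsto u atTop (𝓝 0)) (h : ∀ j, f j = c * (u j - u (j + n))) :
    ∑' j, f j = c * ∑ i ∈ range n, u i := by
  refine tendsto_nhds_unique hf.hasSum.tendsto_sum_nat ?_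
  simp only [h, ← mul_sum]
  exact (tendsto_sum_sub_shift hu n).const_mul c

lemma tendsto_one_div_add_one : Tendsto (fun n : ℕ => 1 / ((n : ℝ) + 1)) atTop (𝓝 0) :=
  tendsto_one_div_add_atTop_nhds_zero_nat

lemma tsum_one_div_mul_add (n : ℕ) :
    ∑' j : ℕ, 1 / (((j : ℝ) + 1) * ((j + 1) + (n + 1))) = hsum (n + 1) / (n + 1) := by
  rw [tsum_eq_of_sub_shift (u := fun j => 1 / ((j : ℝ) + 1)) (c := 1 / ((n : ℝ) + 1)) (n := n + 1)
    ?_ tendsto_one_div_add_one, hsum, one_div_mul_eq_div]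
  · intro j
    push_cast
    have h1 : (j : ℝ) + 1 ≠ 0 := by positivity
    have h2 : (j : ℝ) + 1 + (n + 1) ≠ 0 := by positivity
    have h3 : (j : ℝ) + (n + 1) + 1 ≠ 0 := by positivity
    field_simp
    ring
  · refine summable_one_div_sq.of_nonneg_of_le (fun j => by positivity) fun j => ?_
    rw [sq]
    gcongr <;> linarith [n.cast_nonneg (α := ℝ)]

lemma summable_const_div_sq (c : ℝ) : Summable fun n : ℕ => c / ((n : ℝ) + 1) ^ 2 := by
  simpa [div_eq_mul_inv] using summable_one_div_sq.mul_left c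

lemma one_le_abs_sub_of_ne {k n : ℕ} (h : k ≠ n) : (1 : ℝ) ≤ |(k : ℝ) + 1 - (n + 1)| := by
  have h1 : (1 : ℤ) ≤ |(k : ℤ) - n| := Int.one_le_abs (by lia)
  rw [add_sub_add_right_eq_sub]
  exact_mod_cast h1

lemma abs_one_div_sub_le (k n : ℕ) :
    |1 / (((k : ℝ) + 1) - (n + 1))| ≤ 2 * (n + 1) / (k + 1) := by
  rcases eq_or_ne k n with rfl | h
  · simp; positivity
  have hd := one_le_abs_sub_of_ne h
  have hn : (0 : ℝ) ≤ n := n.cast_nonneg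
  rw [abs_div, abs_one, div_le_div_iff₀ (by linarith) (by positivity)]
  have h3 : (k : ℝ) - n ≤ |(k : ℝ) + 1 - (n + 1)| := by
    have := le_abs_self ((k : ℝ) + 1 - (n + 1)); linarith
  nlinarith

lemma tendsto_one_div_sub (m : ℕ) : Tendsto (fun j : ℕ => 1 / ((j : ℝ) - m)) atTop (𝓝 0) := by
  simp only [one_div]
  exact tendsto_inv_atTop_zero.comp
    (tendsto_atTop_add_const_right _ (-(m : ℝ)) tendsto_natCast_atTop_atTop)

lemma tsum_one_div_mul_sub (n : ℕ) :
    ∑' k : ℕ, 1 / (((k : ℝ) + 1) - (n + 1)) / (k + 1)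
      = 1 / ((n : ℝ) + 1) * (1 / (n + 1) - hsum n) := by
  have hs : Summable fun k : ℕ => 1 / (((k : ℝ) + 1) - (n + 1)) / (k + 1) := by
    refine (summable_const_div_sq (2 * ((n : ℝ) + 1))).of_norm_bounded fun k => ?_
    rw [norm_div, Real.norm_eq_abs, Real.norm_eq_abs, abs_of_pos (by positivity : (0:ℝ) < k + 1),
      sq, ← div_div]
    gcongr
    exact abs_one_div_sub_le k n
  have hd : Summable fun k : ℕ => if k = n then 1 / ((n : ℝ) + 1) ^ 2 else 0 :=
    (hasSum_ite_eq n _).summable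
  have key := tsum_eq_of_sub_shift (f := fun k : ℕ => 1 / (((k : ℝ) + 1) - (n + 1)) / (k + 1) -
    if k = n then 1 / ((n : ℝ) + 1) ^ 2 else 0) (u := fun j : ℕ => 1 / ((j : ℝ) - n))
    (c := 1 / ((n : ℝ) + 1)) (n := n + 1) (hs.sub hd) (tendsto_one_div_sub n) ?_
  · rw [hs.tsum_sub hd, tsum_ite_eq] at key
    have h1 : ∑ i ∈ range (n + 1), 1 / ((i : ℝ) - n) = - hsum n := by
      rw [sum_range_succ, hsum, ← sum_range_reflect, ← sum_neg_distrib]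
      simp only [sub_self, div_zero, add_zero]
      refine sum_congr rfl fun i hi => ?_
      have hi' : i + 1 ≤ n := by simpa using hi
      rw [Nat.sub_sub, Nat.cast_sub (by lia)]
      push_cast
      rw [← div_neg]
      ring
    rw [h1] at key
    have hq : 1 / ((n : ℝ) + 1) ^ 2 = 1 / (n + 1) * (1 / (n + 1)) := by field_simp
    linear_combination key + hq
  · intro j
    have hj : (j : ℝ) + 1 ≠ 0 := by positivity
    have hn : (n : ℝ) + 1 ≠ 0 := by positivity
    rcases eq_or_ne j n with rfl | h
    · simp only [sub_self, div_zero, zero_div, if_true]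
      push_cast
      rw [show (j : ℝ) + (j + 1) - j = j + 1 by ring]
      field_simp
      ring
    · have h' : (j : ℝ) - n ≠ 0 := sub_ne_zero.2 (by exact_mod_cast h)
      simp only [h, if_false]
      rw [show (j : ℝ) + 1 - (n + 1) = j - n by ring]
      push_cast
      rw [show (j : ℝ) + (n + 1) - n = j + 1 by ring]
      field_simp
      ring

lemma abs_one_div_sq_sub_sq_le (n k : ℕ) :
    |1 / (((n : ℝ) + 1) ^ 2 - (k + 1) ^ 2)| ≤ 2 * ((k : ℝ) + 1) / (n + 1) ^ 2 := by
  have hk : (0 : ℝ) ≤ k := k.cast_nonneg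
  have hn : (0 : ℝ) ≤ n := n.cast_nonneg
  have h := abs_one_div_sub_le n k
  rw [sq_sub_sq, mul_comm ((n : ℝ) + 1 + _), ← div_div, abs_div, abs_of_pos (by positivity : (0:ℝ) < n + 1 + (k + 1)),
    sq, ← div_div]
  gcongr <;> linarith

lemma abs_one_div_sq_sub_sq_le' (n k : ℕ) :
    |1 / (((n : ℝ) + 1) ^ 2 - (k + 1) ^ 2)| ≤ 1 / ((k : ℝ) + 1) := by
  rcases eq_or_ne n k with rfl | h
  · simp; positivity
  have hk : (0 : ℝ) ≤ k := k.cast_nonneg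
  have hn : (0 : ℝ) ≤ n := n.cast_nonneg
  have hd := one_le_abs_sub_of_ne h
  rw [sq_sub_sq, abs_div, abs_one, abs_mul, abs_of_pos (by positivity : (0:ℝ) < n + 1 + (k + 1))]
  gcongr
  nlinarith

lemma tendsto_alternating_one_div_sub (m : ℕ) :
    Tendsto (fun j : ℕ => (-1 : ℝ) ^ (j + m) / ((j : ℝ) - m)) atTop (𝓝 0) := by
  refine squeeze_zero_norm (fun j => ?_) (tendsto_zero_iff_norm_tendsto_zero.1 (tendsto_one_div_sub m))
  simp

lemma tsum_alternating_one_div_sq_sub_sq (k : ℕ) :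
    ∑' n : ℕ, (-1 : ℝ) ^ (n + 1) * (1 / (((n : ℝ) + 1) ^ 2 - (k + 1) ^ 2))
      = 1 / (2 * ((k : ℝ) + 1) ^ 2) * (1 + (-1) ^ (k + 1) / 2) := by
  have hs : Summable fun n : ℕ => (-1 : ℝ) ^ (n + 1) * (1 / (((n : ℝ) + 1) ^ 2 - (k + 1) ^ 2)) := by
    refine (summable_const_div_sq (2 * ((k : ℝ) + 1))).of_norm_bounded fun n => ?_
    rw [norm_mul, norm_pow, norm_neg, norm_one, one_pow, one_mul]
    exact abs_one_div_sq_sub_sq_le n k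
  have hd : Summable fun n : ℕ =>
      if n = k then (-1 : ℝ) ^ (k + 1) / (4 * ((k : ℝ) + 1) ^ 2) else 0 :=
    (hasSum_ite_eq k _).summable
  have key := tsum_eq_of_sub_shift (f := fun n : ℕ =>
      (-1 : ℝ) ^ (n + 1) * (1 / (((n : ℝ) + 1) ^ 2 - (k + 1) ^ 2)) -
        if n = k then (-1 : ℝ) ^ (k + 1) / (4 * ((k : ℝ) + 1) ^ 2) else 0)
    (u := fun j : ℕ => (-1 : ℝ) ^ (j + k) / ((j : ℝ) - k))
    (c := (-1) ^ (k + 1) / (2 * ((k : ℝ) + 1))) (n := 2 * (k + 1)) (hs.sub hd)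
    (tendsto_alternating_one_div_sub k) ?_
  · rw [hs.tsum_sub hd, tsum_ite_eq] at key
    have h1 : ∑ i ∈ range (2 * (k + 1)), (-1 : ℝ) ^ (i + k) / ((i : ℝ) - k)
        = (-1) ^ (k + 1) / (k + 1) := by
      rw [show 2 * (k + 1) = 2 * k + 1 + 1 by ring, sum_range_succ]
      have h2 : ∑ i ∈ range (2 * k + 1), (-1 : ℝ) ^ (i + k) / ((i : ℝ) - k) = 0 := by
        have h3 := sum_range_reflect (fun i : ℕ => (-1 : ℝ) ^ (i + k) / ((i : ℝ) - k)) (2 * k + 1)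
        have h4 : ∑ i ∈ range (2 * k + 1), (-1 : ℝ) ^ (2 * k + 1 - 1 - i + k) /
            (((2 * k + 1 - 1 - i : ℕ) : ℝ) - k)
            = - ∑ i ∈ range (2 * k + 1), (-1 : ℝ) ^ (i + k) / ((i : ℝ) - k) := by
          rw [← sum_neg_distrib]
          refine sum_congr rfl fun i hi => ?_
          have hi' : i ≤ 2 * k := by simpa [Nat.lt_succ_iff] using hi
          have h5 : (-1 : ℝ) ^ (2 * k + 1 - 1 - i + k) = (-1) ^ (i + k) := by
            refine neg_one_pow_congr ?_
            simp only [Nat.even_add, Nat.even_sub hi', Nat.add_sub_cancel]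
            simp
          rw [h5, Nat.add_sub_cancel, Nat.cast_sub hi', ← div_neg]
          push_cast
          congr 1
          ring
        linarith
      rw [h2, zero_add, show 2 * k + 1 + k = 2 * k + (k + 1) by ring, pow_add _ (2 * k), pow_mul]
      push_cast
      norm_num
      ring
    rw [h1] at key
    have h6 : ((-1 : ℝ) ^ (k + 1)) * (-1) ^ (k + 1) = 1 := by
      rw [← mul_pow]; norm_num
    have hk : (k : ℝ) + 1 ≠ 0 := by positivity
    rw [sub_eq_iff_eq_add] at key
    rw [key]
    field_simp
    linear_combination 8 * h6
  · intro j
    have hj : (j : ℝ) + 1 ≠ 0 := by positivity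
    have hk : (k : ℝ) + 1 ≠ 0 := by positivity
    have hjk : (j : ℝ) + 1 + (k + 1) ≠ 0 := by positivity
    have e1 : ∀ m : ℕ, (-1 : ℝ) ^ (m + k) * (-1) ^ (k + 1) = (-1) ^ (m + 1) := fun m => by
      rw [← pow_add, show m + k + (k + 1) = 2 * k + (m + 1) by ring, pow_add _ (2 * k), pow_mul]
      norm_num
    have e2 : (-1 : ℝ) ^ (j + 2 * (k + 1) + k) = (-1) ^ (j + k) := by
      rw [show j + 2 * (k + 1) + k = 2 * (k + 1) + (j + k) by ring, pow_add _ (2 * (k + 1)), pow_mul]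
      norm_num
    rw [e2]
    push_cast
    rw [show (j : ℝ) + 2 * (k + 1) - k = j + 1 + (k + 1) by ring]
    rcases eq_or_ne j k with rfl | h
    · simp only [sub_self, div_zero, mul_zero, if_true, zero_sub]
      have := e1 j
      have h7 : (-1 : ℝ) ^ (j + j) = 1 := by rw [← two_mul, pow_mul]; norm_num
      rw [h7]
      field_simp
      ring
    · have h' : (j : ℝ) - k ≠ 0 := sub_ne_zero.2 (by exact_mod_cast h)
      simp only [h, if_false]
      rw [← e1 j, sq_sub_sq, show (j : ℝ) + 1 - (k + 1) = j - k by ring]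
      field_simp
      ring

lemma one_div_add_le {z : ℝ} (hz : -1 < z) (j : ℕ) :
    1 / ((j : ℝ) + 1 + z) ≤ (1 + 1 / (1 + z)) / (j + 1) := by
  have hc : 0 < 1 + z := by linarith
  have hj : (0 : ℝ) ≤ j := j.cast_nonneg
  rw [div_le_div_iff₀ (by linarith) (by positivity)]
  have h : (1 + 1 / (1 + z)) * ((j : ℝ) + 1 + z) = j + 1 + z + j / (1 + z) + 1 := by
    field_simp
    ring
  have : 0 ≤ (j : ℝ) / (1 + z) := by positivity
  linarith

lemma one_div_add_nonneg {z : ℝ} (hz : -1 < z) (j : ℕ) : 0 ≤ 1 / ((j : ℝ) + 1 + z) := by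
  have hj : (0 : ℝ) ≤ j := j.cast_nonneg
  exact one_div_nonneg.2 (by linarith)

lemma summable_one_div_mul_add {z : ℝ} (hz : -1 < z) :
    Summable fun j : ℕ => 1 / (((j : ℝ) + 1) * (j + 1 + z)) := by
  refine (summable_const_div_sq (1 + 1 / (1 + z))).of_nonneg_of_le (fun j => ?_) fun j => ?_
  · rw [mul_comm, ← div_div]
    exact div_nonneg (one_div_add_nonneg hz j) (by positivity)
  · rw [mul_comm, ← div_div, sq, ← div_div]
    exact div_le_div_of_nonneg_right (one_div_add_le hz j) (by positivity)

lemma one_div_mul_one_div_split {z : ℝ} (hz : -1 < z) (w : ℝ) (k j : ℕ) :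
    w / ((k : ℝ) + 1) * (1 / (((j : ℝ) + 1) * (j + 1 + z)))
      = w / ((k : ℝ) + 1) * (1 / (((j : ℝ) + 1) * ((j + 1) + (k + 1))))
        + w * ((k + 1) - z) / (((k : ℝ) + 1) * ((k + 1) + (j + 1)))
          / (((j : ℝ) + 1) * (j + 1 + z)) := by
  have e1 : (k : ℝ) + 1 ≠ 0 := by positivity
  have e2 : (j : ℝ) + 1 ≠ 0 := by positivity
  have e3 : (k : ℝ) + 1 + (j + 1) ≠ 0 := by positivity
  have e5 : (j : ℝ) + 1 + z ≠ 0 := by linarith [j.cast_nonneg (α := ℝ)]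
  rw [add_comm ((j : ℝ) + 1) (k + 1)]
  field_simp
  ring

/-- Product of the partial fraction sums over `1/(k(k-z))` and `1/(j(j+z))`, expanded through
`1/((k-z)(j+z)) = (1/(k-z) + 1/(j+z))/(k+j)`. The weight `w k` stands for `1/(k-z)`,
and `δ` records a possible omitted pole. -/
lemma tsum_mul_tsum_eq {z C : ℝ} (hz : -1 < z) {w δ : ℕ → ℝ}
    (hw : ∀ k : ℕ, |w k| ≤ C / (k + 1)) (hδ : ∀ k : ℕ, w k * ((k + 1) - z) = δ k)
    (hδ1 : ∀ k, |δ k| ≤ 1) :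
    (∑' k : ℕ, w k / (k + 1)) * (∑' j : ℕ, 1 / (((j : ℝ) + 1) * (j + 1 + z)))
      = (∑' k : ℕ, w k * (hsum (k + 1) / (k + 1)) / (k + 1))
        + ∑' j : ℕ, (∑' k : ℕ, δ k / (((k : ℝ) + 1) * ((k + 1) + (j + 1))))
            / (((j : ℝ) + 1) * (j + 1 + z)) := by
  have hwC : ∀ k : ℕ, |w k / ((k : ℝ) + 1)| ≤ C / ((k : ℝ) + 1) ^ 2 := fun k => by
    rw [abs_div, abs_of_pos (by positivity : (0 : ℝ) < k + 1), sq, ← div_div]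
    gcongr
    exact hw k
  have hsw : Summable fun k : ℕ => w k / ((k : ℝ) + 1) :=
    (summable_const_div_sq C).of_norm_bounded hwC
  have hsz := summable_one_div_mul_add hz
  have h1 : Summable fun p : ℕ × ℕ =>
      w p.1 / ((p.1 : ℝ) + 1) * (1 / (((p.2 : ℝ) + 1) * ((p.2 + 1) + (p.1 + 1)))) := by
    refine ((summable_norm_iff.2 hsw).mul_of_nonneg summable_one_div_sq (fun _ => norm_nonneg _)
      fun _ => by positivity).of_norm_bounded fun p => ?_
    rw [norm_mul, Real.norm_of_nonneg (r := 1 / _) (by positivity)]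
    gcongr
    rw [sq]
    gcongr <;> linarith [p.1.cast_nonneg (α := ℝ)]
  have h2 : Summable fun p : ℕ × ℕ =>
      δ p.1 / (((p.1 : ℝ) + 1) * ((p.1 + 1) + (p.2 + 1))) / (((p.2 : ℝ) + 1) * (p.2 + 1 + z)) := by
    refine (summable_one_div_sq.mul_of_nonneg (summable_norm_iff.2 hsz) (fun _ => by positivity)
      fun _ => norm_nonneg _).of_norm_bounded fun p => ?_
    rw [div_eq_mul_one_div _ (((p.2 : ℝ) + 1) * _), norm_mul, norm_div,
      Real.norm_of_nonneg (r := _ * _) (by positivity), sq]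
    gcongr
    · exact hδ1 p.1
    all_goals linarith [p.2.cast_nonneg (α := ℝ)]
  rw [tsum_mul_tsum_of_summable_norm hsw.norm hsz.norm]
  have hsplit : ∀ p : ℕ × ℕ, w p.1 / ((p.1 : ℝ) + 1) * (1 / (((p.2 : ℝ) + 1) * (p.2 + 1 + z)))
      = w p.1 / ((p.1 : ℝ) + 1) * (1 / (((p.2 : ℝ) + 1) * ((p.2 + 1) + (p.1 + 1))))
        + δ p.1 / (((p.1 : ℝ) + 1) * ((p.1 + 1) + (p.2 + 1)))
          / (((p.2 : ℝ) + 1) * (p.2 + 1 + z)) := fun p => by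
    rw [← hδ]
    exact one_div_mul_one_div_split hz _ _ _
  rw [tsum_congr hsplit, h1.tsum_add h2, h1.tsum_prod]
  congr 1
  · refine tsum_congr fun k => ?_
    dsimp only
    rw [tsum_mul_left, tsum_one_div_mul_add]
    ring
  · rw [h2.tsum_prod]
    dsimp only
    rw [← Summable.tsum_comm (f := fun k j : ℕ =>
      δ k / (((k : ℝ) + 1) * ((k + 1) + (j + 1))) / (((j : ℝ) + 1) * (j + 1 + z))) h2]
    refine tsum_congr fun j => ?_
    simp only [tsum_div_const]

lemma summable_hsum_succ_div {z : ℝ} (hz : -1 < z) :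
    Summable fun k : ℕ => hsum (k + 1) / (k + 1) / (((k : ℝ) + 1) * (k + 1 + z)) := by
  refine (summable_hsum_succ.mul_left (1 + 1 / (1 + z))).of_nonneg_of_le (fun k => ?_) fun k => ?_
  · rw [mul_comm, ← div_div _ (_ + z)]
    have := one_div_add_nonneg hz k
    rw [div_eq_mul_one_div _ (_ + z)]
    have := hsum_nonneg (k + 1)
    positivity
  · have h := one_div_add_le hz k
    have h0 := hsum_nonneg (k + 1)
    calc hsum (k + 1) / (k + 1) / (((k : ℝ) + 1) * (k + 1 + z))
        = hsum (k + 1) / ((k : ℝ) + 1) ^ 2 * (1 / (k + 1 + z)) := by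
          rw [mul_one_div, div_div, div_div, sq, mul_assoc]
      _ ≤ hsum (k + 1) / ((k : ℝ) + 1) ^ 2 * (1 + 1 / (1 + z)) := by
          refine mul_le_mul_of_nonneg_left (h.trans (div_le_self ?_ ?_)) (by positivity)
          · have : 0 < 1 + z := by linarith
            positivity
          · linarith [k.cast_nonneg (α := ℝ)]
      _ = _ := mul_comm _ _

/-- The product `(ψ(1-s)+γ)(ψ(1+s)+γ)` as a single series, up to the factor `-s²`. -/
lemma tsum_mul_tsum_one_div {s : ℝ} (hs : |s| < 1) :
    (∑' k : ℕ, 1 / (((k : ℝ) + 1) * (k + 1 + -s))) *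
      (∑' j : ℕ, 1 / (((j : ℝ) + 1) * (j + 1 + s)))
      = 2 * ∑' k : ℕ, hsum (k + 1) / (k + 1) * (1 / (((k : ℝ) + 1) ^ 2 - s ^ 2)) := by
  obtain ⟨hs1, hs2⟩ := abs_lt.1 hs
  have hk : ∀ k : ℕ, (0 : ℝ) ≤ k := fun k => k.cast_nonneg
  have hm : ∀ k : ℕ, (k : ℝ) + 1 + -s ≠ 0 := fun k => by linarith [hk k]
  have hp : ∀ k : ℕ, (k : ℝ) + 1 + s ≠ 0 := fun k => by linarith [hk k]
  have key := tsum_mul_tsum_eq (z := s) (C := 1 + 1 / (1 + -s)) hs1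
    (w := fun k => 1 / ((k : ℝ) + 1 + -s)) (δ := fun _ => 1) (fun k => by
      rw [abs_of_nonneg (one_div_add_nonneg (by linarith) k)]
      exact one_div_add_le (by linarith) k)
    (fun k => by rw [one_div, ← sub_eq_add_neg, inv_mul_cancel₀]; simpa [sub_eq_add_neg] using hm k)
    (fun k => by simp)
  have e1 : ∀ k : ℕ, 1 / (((k : ℝ) + 1) * (k + 1 + -s)) = 1 / ((k : ℝ) + 1 + -s) / (k + 1) :=
    fun k => by rw [div_div, mul_comm]
  simp only [e1]
  rw [key, ← tsum_mul_left]
  simp only [tsum_one_div_mul_add]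
  have e2 : ∀ k : ℕ, 1 / ((k : ℝ) + 1 + -s) * (hsum (k + 1) / (k + 1)) / (k + 1)
      = hsum (k + 1) / (k + 1) / (((k : ℝ) + 1) * (k + 1 + -s)) := fun k => by
    rw [one_div_mul_eq_div]
    field_simp
  simp only [e2]
  rw [← (summable_hsum_succ_div (by linarith)).tsum_add (summable_hsum_succ_div hs1)]
  refine tsum_congr fun k => ?_
  have h1 := hm k
  have h2 := hp k
  have h3 : ((k : ℝ) + 1) ^ 2 - s ^ 2 ≠ 0 := by
    rw [sq_sub_sq]
    exact mul_ne_zero h2 (by simpa [sub_eq_add_neg] using h1)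
  have h4 : (k : ℝ) + 1 ≠ 0 := by positivity
  field_simp
  ring

lemma tsum_one_div_add_sq (n : ℕ) :
    ∑' j : ℕ, 1 / ((j : ℝ) + 1 + (n + 1)) ^ 2
      = π ^ 2 / 6 - ∑ i ∈ range (n + 1), 1 / ((i : ℝ) + 1) ^ 2 := by
  have hz : ∑' i : ℕ, 1 / ((i : ℝ) + 1) ^ 2 = π ^ 2 / 6 := by
    have h := (hasSum_nat_add_iff' 1).2 hasSum_zeta_two
    simpa using h.tsum_eq
  have h := summable_one_div_sq.sum_add_tsum_nat_add (n + 1)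
  rw [hz] at h
  rw [← h, add_sub_cancel_left]
  refine tsum_congr fun j => ?_
  push_cast
  ring_nf

lemma summable_hsum_mul_one_div_sq_sub_sq (n : ℕ) : Summable fun k : ℕ =>
    hsum (k + 1) / (k + 1) * (1 / (((k : ℝ) + 1) ^ 2 - (n + 1) ^ 2)) := by
  refine (summable_hsum_succ.mul_left (2 * ((n : ℝ) + 1))).of_norm_bounded fun k => ?_
  have h0 := hsum_nonneg (k + 1)
  rw [norm_mul, Real.norm_of_nonneg (by positivity), Real.norm_eq_abs]
  calc hsum (k + 1) / (k + 1) * |1 / (((k : ℝ) + 1) ^ 2 - (n + 1) ^ 2)|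
      ≤ hsum (k + 1) / 1 * (2 * (n + 1) / ((k : ℝ) + 1) ^ 2) := by
        gcongr
        · linarith [k.cast_nonneg (α := ℝ)]
        · exact abs_one_div_sq_sub_sq_le k n
    _ = _ := by ring

lemma tsum_hsum_succ_mul_one_div_sq_sub_sq (n : ℕ) :
    ∑' k : ℕ, hsum (k + 1) / (k + 1) * (1 / (((k : ℝ) + 1) ^ 2 - (n + 1) ^ 2))
      = 1 / (2 * ((n : ℝ) + 1) ^ 2) * ((2 / (n + 1) - hsum (n + 1)) * hsum (n + 1)
          + hsum (n + 1) / (2 * (n + 1)) - π ^ 2 / 6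
          + ∑ i ∈ range (n + 1), 1 / ((i : ℝ) + 1) ^ 2) := by
  have hn : (-1 : ℝ) < n + 1 := by linarith [n.cast_nonneg (α := ℝ)]
  have hN : (n : ℝ) + 1 ≠ 0 := by positivity
  have key := tsum_mul_tsum_eq (z := (n : ℝ) + 1) (C := 2 * ((n : ℝ) + 1)) hn
    (w := fun k => 1 / ((k : ℝ) + 1 - (n + 1))) (δ := fun k => if k = n then 0 else 1)
    (fun k => abs_one_div_sub_le k n)
    (fun k => by
      split_ifs with h
      · simp [h]
      · have : (k : ℝ) + 1 - (n + 1) ≠ 0 := by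
          rw [add_sub_add_right_eq_sub]
          exact sub_ne_zero.2 (by exact_mod_cast h)
        rw [one_div, inv_mul_cancel₀ this])
    (fun k => by split_ifs <;> simp)
  rw [tsum_one_div_mul_sub, tsum_one_div_mul_add] at key
  have hδ : ∀ j : ℕ, ∑' k : ℕ, (if k = n then (0 : ℝ) else 1) / (((k : ℝ) + 1) * ((k + 1) + (j + 1)))
      = hsum (j + 1) / (j + 1) - 1 / (((n : ℝ) + 1) * ((n + 1) + (j + 1))) := fun j => by
    have h1 : Summable fun k : ℕ => 1 / (((k : ℝ) + 1) * ((k + 1) + (j + 1))) :=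
      summable_one_div_mul_add (by linarith [j.cast_nonneg (α := ℝ)])
    have h2 : Summable fun k : ℕ => if k = n then 1 / (((n : ℝ) + 1) * ((n + 1) + (j + 1))) else 0 :=
      (hasSum_ite_eq n _).summable
    have h3 := h1.tsum_sub h2
    rw [tsum_one_div_mul_add, tsum_ite_eq] at h3
    rw [← h3]
    refine tsum_congr fun k => ?_
    split_ifs with h
    · simp [h]
    · simp
  simp only [hδ] at key
  have s1 := summable_hsum_succ_div hn
  have s2 := summable_one_div_mul_add hn
  have s3 : Summable fun j : ℕ => 1 / ((j : ℝ) + 1 + (n + 1)) ^ 2 := by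
    refine ((summable_nat_add_iff (n + 1)).2 summable_one_div_sq).congr fun j => ?_
    push_cast
    ring_nf
  have h4 : ∑' j : ℕ, (hsum (j + 1) / (j + 1) - 1 / (((n : ℝ) + 1) * ((n + 1) + (j + 1))))
        / (((j : ℝ) + 1) * (j + 1 + (n + 1)))
      = ∑' j : ℕ, hsum (j + 1) / (j + 1) / (((j : ℝ) + 1) * (j + 1 + (n + 1)))
        - 1 / ((n : ℝ) + 1) ^ 2 * (hsum (n + 1) / (n + 1)
          - (π ^ 2 / 6 - ∑ i ∈ range (n + 1), 1 / ((i : ℝ) + 1) ^ 2)) := by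
    rw [← tsum_one_div_add_sq, ← tsum_one_div_mul_add, ← s2.tsum_sub s3, ← tsum_mul_left,
      ← s1.tsum_sub ((s2.sub s3).mul_left _)]
    refine tsum_congr fun j => ?_
    have e1 : (j : ℝ) + 1 ≠ 0 := by positivity
    have e2 : (j : ℝ) + 1 + (n + 1) ≠ 0 := by positivity
    have e3 : (n : ℝ) + 1 + (j + 1) ≠ 0 := by positivity
    field_simp
    ring
  rw [h4] at key
  have s4 := summable_hsum_mul_one_div_sq_sub_sq n
  have s5 : Summable fun k : ℕ => if k = n then hsum (n + 1) / (2 * ((n : ℝ) + 1) ^ 3) else 0 :=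
    (hasSum_ite_eq n _).summable
  have h5 : ∑' k : ℕ, 1 / ((k : ℝ) + 1 - (n + 1)) * (hsum (k + 1) / (k + 1)) / (k + 1)
      = 2 * (∑' k : ℕ, hsum (k + 1) / (k + 1) * (1 / (((k : ℝ) + 1) ^ 2 - (n + 1) ^ 2)))
        + hsum (n + 1) / (2 * ((n : ℝ) + 1) ^ 3)
        - ∑' j : ℕ, hsum (j + 1) / (j + 1) / (((j : ℝ) + 1) * (j + 1 + (n + 1))) := by
    rw [← tsum_mul_left, ← tsum_ite_eq n (fun _ => hsum (n + 1) / (2 * ((n : ℝ) + 1) ^ 3)),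
      ← (s4.mul_left 2).tsum_add s5, ← ((s4.mul_left 2).add s5).tsum_sub s1]
    refine tsum_congr fun k => ?_
    have e1 : (k : ℝ) + 1 ≠ 0 := by positivity
    have e2 : (k : ℝ) + 1 + (n + 1) ≠ 0 := by positivity
    split_ifs with h
    · subst h
      simp
      field_simp
      ring
    · have e3 : (k : ℝ) - n ≠ 0 := sub_ne_zero.2 (by exact_mod_cast h)
      rw [sq_sub_sq, add_sub_add_right_eq_sub]
      field_simp
      ring
  rw [h5, hsum_succ] at key
  rw [hsum_succ]
  field_simp at key ⊢
  linear_combination (-1) * key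

lemma tsum_hsum_mul_one_div_sq_sub_sq (n : ℕ) :
    ((n : ℝ) + 1) ^ 2 * ∑' k : ℕ, hsum k / (k + 1) * (1 / (((k : ℝ) + 1) ^ 2 - (n + 1) ^ 2))
      = - esum n + hsum n / (4 * (n + 1)) - 1 / (2 * ((n : ℝ) + 1) ^ 2) + π ^ 2 / 12 := by
  have hN : (n : ℝ) + 1 ≠ 0 := by positivity
  have s1 := summable_hsum_mul_one_div_sq_sub_sq n
  have s2 : Summable fun k : ℕ => 1 / ((k : ℝ) + 1 - (n + 1)) / (k + 1) := by
    refine (summable_const_div_sq (2 * ((n : ℝ) + 1))).of_norm_bounded fun k => ?_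
    rw [norm_div, Real.norm_eq_abs, Real.norm_eq_abs, abs_of_pos (by positivity : (0:ℝ) < k + 1),
      sq, ← div_div]
    gcongr
    exact abs_one_div_sub_le k n
  have s3 := summable_one_div_mul_add (z := (n : ℝ) + 1) (by linarith [n.cast_nonneg (α := ℝ)])
  have s4 := summable_one_div_sq
  have s5 : Summable fun k : ℕ => if k = n then 3 / (4 * ((n : ℝ) + 1) ^ 4) else 0 :=
    (hasSum_ite_eq n _).summable
  have hz : ∑' i : ℕ, 1 / ((i : ℝ) + 1) ^ 2 = π ^ 2 / 6 := by
    have h := (hasSum_nat_add_iff' 1).2 hasSum_zeta_two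
    simpa using h.tsum_eq
  have h : ∑' k : ℕ, hsum k / (k + 1) * (1 / (((k : ℝ) + 1) ^ 2 - (n + 1) ^ 2))
      = ∑' k : ℕ, hsum (k + 1) / (k + 1) * (1 / (((k : ℝ) + 1) ^ 2 - (n + 1) ^ 2))
        - 1 / ((n : ℝ) + 1) ^ 2 * (1 / 2 * (1 / ((n : ℝ) + 1) * (1 / (n + 1) - hsum n)
          + hsum (n + 1) / (n + 1)) - π ^ 2 / 6) - 3 / (4 * ((n : ℝ) + 1) ^ 4) := by
    rw [← tsum_one_div_mul_sub, ← tsum_one_div_mul_add, ← hz,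
      ← tsum_ite_eq n (fun _ => 3 / (4 * ((n : ℝ) + 1) ^ 4)), ← s2.tsum_add s3, ← tsum_mul_left,
      ← ((s2.add s3).mul_left _).tsum_sub s4, ← tsum_mul_left,
      ← s1.tsum_sub ((((s2.add s3).mul_left _).sub s4).mul_left _),
      ← (s1.sub ((((s2.add s3).mul_left _).sub s4).mul_left _)).tsum_sub s5]
    refine tsum_congr fun k => ?_
    have e1 : (k : ℝ) + 1 ≠ 0 := by positivity
    have e2 : (k : ℝ) + 1 + (n + 1) ≠ 0 := by positivity
    rw [hsum_succ]
    split_ifs with h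
    · subst h
      simp
      field_simp
      ring
    · have e3 : (k : ℝ) - n ≠ 0 := sub_ne_zero.2 (by exact_mod_cast h)
      rw [sq_sub_sq, add_sub_add_right_eq_sub]
      field_simp
      ring
  have he := two_mul_esum n
  rw [h, tsum_hsum_succ_mul_one_div_sq_sub_sq, sum_range_succ, hsum_succ]
  field_simp
  linear_combination 576 * ((n : ℝ) + 1) ^ 2 * he

lemma sq_sub_pos {x : ℝ} (hx : x < 1) (n : ℕ) : 0 < ((n : ℝ) + 1) ^ 2 - x := by
  nlinarith [n.cast_nonneg (α := ℝ)]

lemma one_div_sq_sub_le {x : ℝ} (hx : x < 1) (n : ℕ) :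
    1 / (((n : ℝ) + 1) ^ 2 - x) ≤ (1 + 1 / (1 - x)) / ((n : ℝ) + 1) ^ 2 := by
  have hc : 0 < 1 - x := by linarith
  rw [div_le_div_iff₀ (sq_sub_pos hx n) (by positivity)]
  have h : (1 + 1 / (1 - x)) * (((n : ℝ) + 1) ^ 2 - x)
      = ((n : ℝ) + 1) ^ 2 + (1 - x) + (((n : ℝ) + 1) ^ 2 - 1) / (1 - x) := by
    field_simp
    ring
  have h2 : 0 ≤ (((n : ℝ) + 1) ^ 2 - 1) / (1 - x) :=
    div_nonneg (by nlinarith [n.cast_nonneg (α := ℝ)]) hc.le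
  linarith

lemma summable_mul_one_div_sq_sub {c : ℕ → ℝ} (hc : Summable fun n : ℕ => c n / ((n : ℝ) + 1) ^ 2)
    {x : ℝ} (hx : x < 1) : Summable fun n : ℕ => c n * (1 / (((n : ℝ) + 1) ^ 2 - x)) := by
  refine (hc.norm.mul_left (1 + 1 / (1 - x))).of_norm_bounded fun n => ?_
  have h := sq_sub_pos hx n
  rw [norm_mul, Real.norm_of_nonneg (one_div_nonneg.2 h.le), norm_div,
    Real.norm_of_nonneg (r := ((n : ℝ) + 1) ^ 2) (by positivity)]
  calc ‖c n‖ * (1 / (((n : ℝ) + 1) ^ 2 - x))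
      ≤ ‖c n‖ * ((1 + 1 / (1 - x)) / ((n : ℝ) + 1) ^ 2) := by
        exact mul_le_mul_of_nonneg_left (one_div_sq_sub_le hx n) (norm_nonneg _)
    _ = _ := by ring

lemma abs_neg_one_pow_mul (n : ℕ) (a : ℝ) : ‖(-1 : ℝ) ^ n * a‖ = ‖a‖ := by simp

lemma summable_sign_div {c : ℕ → ℝ} {d : ℕ → ℝ} (hc : Summable fun n : ℕ => c n / d n) :
    Summable fun n : ℕ => (-1) ^ (n + 1) * c n / d n := by
  refine hc.norm.of_norm_bounded fun n => ?_
  rw [mul_div_assoc, abs_neg_one_pow_mul]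

lemma summable_hsum_div_div : Summable fun n : ℕ => hsum n / (n + 1) / ((n : ℝ) + 1) ^ 2 := by
  refine summable_hsum.of_nonneg_of_le (fun n => ?_) fun n => ?_
  · have := hsum_nonneg n
    positivity
  · gcongr
    exact div_le_self (hsum_nonneg n) (by linarith [n.cast_nonneg (α := ℝ)])

/-- The series for `π s / sin (π s)` in the variable `x = s²`. -/
noncomputable def cscSeries (x : ℝ) : ℝ :=
  1 - 2 * x * ∑' n : ℕ, (-1) ^ (n + 1) * (1 / (((n : ℝ) + 1) ^ 2 - x))

/-- The series `∑_{k ≥ 1} H_{k-1} / (k (k² - x))`. -/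
noncomputable def harmonicSeries (x : ℝ) : ℝ :=
  ∑' k : ℕ, hsum k / (k + 1) * (1 / (((k : ℝ) + 1) ^ 2 - x))

/-- Coefficient of the simple pole of `cscSeries * harmonicSeries / 2` at `(n+1)²`, up to sign. -/
noncomputable def poleCoeff (n : ℕ) : ℝ :=
  esum n + hsum n / (2 * (n + 1)) - π ^ 2 / 12 + 1 / (2 * ((n : ℝ) + 1) ^ 2)

/-- The partial fraction series of `cscSeries * harmonicSeries / 2`. -/
noncomputable def poleSeries (x : ℝ) : ℝ :=
  ∑' n : ℕ, (-1) ^ (n + 1) * (poleCoeff n * (1 / (((n : ℝ) + 1) ^ 2 - x))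
    - (n + 1) * hsum n * (1 / (((n : ℝ) + 1) ^ 2 - x)) ^ 2)

lemma summable_poleCoeff : Summable fun n : ℕ => poleCoeff n / ((n : ℝ) + 1) ^ 2 := by
  have h4 : Summable fun n : ℕ => 1 / (2 * ((n : ℝ) + 1) ^ 2) / ((n : ℝ) + 1) ^ 2 := by
    refine summable_one_div_sq.of_nonneg_of_le (fun n => by positivity) fun n => ?_
    gcongr
    rw [div_le_one (by positivity)]
    nlinarith [n.cast_nonneg (α := ℝ)]
  refine (((summable_esum.add (summable_hsum_div_div.mul_left (1 / 2))).sub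
    (summable_const_div_sq (π ^ 2 / 12))).add h4).congr fun n => ?_
  rw [poleCoeff]
  field_simp

lemma one_div_sq_sub_mul_split {x : ℝ} (hx : x < 1) (t : ℝ) (n k : ℕ) :
    (-1) ^ (n + 1) * (1 / (((n : ℝ) + 1) ^ 2 - x)) * (t * (1 / (((k : ℝ) + 1) ^ 2 - x)))
      - (-1) ^ (n + 1) * (1 / (((n : ℝ) + 1) ^ 2 - (k + 1) ^ 2))
          * (t * (1 / (((k : ℝ) + 1) ^ 2 - x)))
      - (-1) ^ (n + 1) * (1 / (((n : ℝ) + 1) ^ 2 - x))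
          * (t * (1 / (((k : ℝ) + 1) ^ 2 - (n + 1) ^ 2)))
      = if k = n then (-1) ^ (n + 1) * t * (1 / (((n : ℝ) + 1) ^ 2 - x)) ^ 2 else 0 := by
  have hn := (sq_sub_pos hx n).ne'
  have hk := (sq_sub_pos hx k).ne'
  split_ifs with h
  · subst h
    simp only [sub_self, div_zero]
    ring
  · have h1 : (n : ℝ) - k ≠ 0 := sub_ne_zero.2 (by exact_mod_cast Ne.symm h)
    have h2 : ((n : ℝ) + 1) ^ 2 - (k + 1) ^ 2 ≠ 0 := by
      rw [sq_sub_sq, add_sub_add_right_eq_sub]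
      exact mul_ne_zero (by positivity) h1
    have h3 : ((k : ℝ) + 1) ^ 2 - (n + 1) ^ 2 = -(((n : ℝ) + 1) ^ 2 - (k + 1) ^ 2) := by ring
    rw [h3, div_neg]
    generalize hd : ((n : ℝ) + 1) ^ 2 - (k + 1) ^ 2 = d at *
    have h4 : ((n : ℝ) + 1) ^ 2 - x = d + (((k : ℝ) + 1) ^ 2 - x) := by rw [← hd]; ring
    rw [h4] at hn ⊢
    generalize ((k : ℝ) + 1) ^ 2 - x = b at *
    field_simp
    ring

lemma tsum_mul_tsum_one_div_sq_sub {x : ℝ} (hx : x < 1) {t : ℕ → ℝ} (ht0 : ∀ k, 0 ≤ t k)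
    (ht : Summable fun k : ℕ => t k / ((k : ℝ) + 1)) :
    (∑' n : ℕ, (-1) ^ (n + 1) * (1 / (((n : ℝ) + 1) ^ 2 - x))) *
      (∑' k : ℕ, t k * (1 / (((k : ℝ) + 1) ^ 2 - x)))
      = ∑' k : ℕ, (∑' n : ℕ, (-1) ^ (n + 1) * (1 / (((n : ℝ) + 1) ^ 2 - (k + 1) ^ 2)))
            * (t k * (1 / (((k : ℝ) + 1) ^ 2 - x)))
        + ∑' n : ℕ, (-1) ^ (n + 1) * (1 / (((n : ℝ) + 1) ^ 2 - x))
            * (∑' k : ℕ, t k * (1 / (((k : ℝ) + 1) ^ 2 - (n + 1) ^ 2)))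
        + ∑' n : ℕ, (-1) ^ (n + 1) * t n * (1 / (((n : ℝ) + 1) ^ 2 - x)) ^ 2 := by
  have ht2 : Summable fun k : ℕ => t k / ((k : ℝ) + 1) ^ 2 := by
    refine ht.of_nonneg_of_le (fun k => div_nonneg (ht0 k) (by positivity)) fun k => ?_
    have := ht0 k
    gcongr
    nlinarith [k.cast_nonneg (α := ℝ)]
  have hM : 0 < 1 + 1 / (1 - x) := by
    have : 0 < 1 - x := by linarith
    positivity
  have hG : ∀ k : ℕ, 0 ≤ 1 / (((k : ℝ) + 1) ^ 2 - x) := fun k =>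
    one_div_nonneg.2 (sq_sub_pos hx k).le
  have sn : Summable fun n : ℕ => (-1 : ℝ) ^ (n + 1) * (1 / (((n : ℝ) + 1) ^ 2 - x)) := by
    refine summable_mul_one_div_sq_sub ?_ hx
    simpa using summable_sign_div summable_one_div_sq
  have sk := summable_mul_one_div_sq_sub ht2 hx
  have s1 : Summable fun p : ℕ × ℕ =>
      (-1 : ℝ) ^ (p.1 + 1) * (1 / (((p.1 : ℝ) + 1) ^ 2 - (p.2 + 1) ^ 2))
        * (t p.2 * (1 / (((p.2 : ℝ) + 1) ^ 2 - x))) := by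
    refine ((summable_const_div_sq 2).mul_of_nonneg (ht.mul_left (1 + 1 / (1 - x)))
      (fun _ => by positivity)
      fun k => mul_nonneg hM.le (div_nonneg (ht0 k) (by positivity))).of_norm_bounded fun p => ?_
    rw [mul_assoc, abs_neg_one_pow_mul, norm_mul, norm_mul, Real.norm_of_nonneg (ht0 _),
      Real.norm_of_nonneg (hG _)]
    calc ‖1 / (((p.1 : ℝ) + 1) ^ 2 - (p.2 + 1) ^ 2)‖ * (t p.2 * (1 / (((p.2 : ℝ) + 1) ^ 2 - x)))
        ≤ (2 * ((p.2 : ℝ) + 1) / (p.1 + 1) ^ 2)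
          * (t p.2 * ((1 + 1 / (1 - x)) / ((p.2 : ℝ) + 1) ^ 2)) :=
          mul_le_mul (abs_one_div_sq_sub_sq_le p.1 p.2)
            (mul_le_mul_of_nonneg_left (one_div_sq_sub_le hx p.2) (ht0 _))
            (mul_nonneg (ht0 _) (hG _)) (by positivity)
      _ = _ := by
        generalize 1 + 1 / (1 - x) = M
        field_simp
  have s2 : Summable fun p : ℕ × ℕ =>
      (-1 : ℝ) ^ (p.1 + 1) * (1 / (((p.1 : ℝ) + 1) ^ 2 - x))
        * (t p.2 * (1 / (((p.2 : ℝ) + 1) ^ 2 - (p.1 + 1) ^ 2))) := by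
    refine (sn.norm.mul_of_nonneg ht (fun _ => norm_nonneg _)
      fun k => (div_nonneg (ht0 k) (by positivity))).of_norm_bounded fun p => ?_
    rw [norm_mul, norm_mul (t _), Real.norm_of_nonneg (ht0 _), div_eq_mul_one_div (t p.2)]
    gcongr
    · exact ht0 _
    · rw [Real.norm_eq_abs, abs_div, abs_sub_comm, ← abs_div]
      exact abs_one_div_sq_sub_sq_le' p.1 p.2
  have s0 : Summable fun p : ℕ × ℕ => (-1 : ℝ) ^ (p.1 + 1) * (1 / (((p.1 : ℝ) + 1) ^ 2 - x))
      * (t p.2 * (1 / (((p.2 : ℝ) + 1) ^ 2 - x))) :=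
    summable_mul_of_summable_norm sn.norm sk.norm
  have s3 := ((s0.sub s1).sub s2).congr fun p => one_div_sq_sub_mul_split hx (t p.2) p.1 p.2
  have h := ((s0.sub s1).tsum_sub s2).symm.trans
    (tsum_congr fun p => one_div_sq_sub_mul_split hx (t p.2) p.1 p.2)
  rw [s0.tsum_sub s1, ← tsum_mul_tsum_of_summable_norm sn.norm sk.norm, s2.tsum_prod,
    s3.tsum_prod, s1.tsum_prod] at h
  dsimp only at h
  rw [← Summable.tsum_comm (f := fun n k : ℕ =>
      (-1 : ℝ) ^ (n + 1) * (1 / (((n : ℝ) + 1) ^ 2 - (k + 1) ^ 2))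
        * (t k * (1 / (((k : ℝ) + 1) ^ 2 - x)))) s1] at h
  simp only [tsum_mul_left, tsum_mul_right] at h
  have h3 : ∀ n : ℕ, (∑' k : ℕ, if k = n then
      (-1 : ℝ) ^ (n + 1) * t k * (1 / (((n : ℝ) + 1) ^ 2 - x)) ^ 2 else 0)
      = (-1 : ℝ) ^ (n + 1) * t n * (1 / (((n : ℝ) + 1) ^ 2 - x)) ^ 2 := fun n =>
    tsum_ite_eq n fun k => (-1 : ℝ) ^ (n + 1) * t k * (1 / (((n : ℝ) + 1) ^ 2 - x)) ^ 2
  rw [tsum_congr h3] at h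
  linarith

lemma summable_hsum_div_mul {x : ℝ} (hx : x < 1) : Summable fun n : ℕ =>
    (n + 1) * hsum n * (1 / (((n : ℝ) + 1) ^ 2 - x)) ^ 2 := by
  have h := summable_mul_one_div_sq_sub (c := fun n : ℕ =>
    (n + 1) * hsum n * (1 / (((n : ℝ) + 1) ^ 2 - x))) ?_ hx
  · refine h.congr fun n => ?_
    rw [mul_assoc, ← sq]
  · refine (summable_mul_one_div_sq_sub summable_hsum_div_div hx).congr fun n => ?_
    have := (sq_sub_pos hx n).ne'
    field_simp

lemma summable_neg_one_pow_mul {f : ℕ → ℝ} (hf : Summable f) :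
    Summable fun n : ℕ => (-1) ^ (n + 1) * f n :=
  hf.norm.of_norm_bounded fun _ => (abs_neg_one_pow_mul _ _).le

lemma summable_poleSeries {x : ℝ} (hx : x < 1) : Summable fun n : ℕ =>
    (-1) ^ (n + 1) * (poleCoeff n * (1 / (((n : ℝ) + 1) ^ 2 - x))
    - (n + 1) * hsum n * (1 / (((n : ℝ) + 1) ^ 2 - x)) ^ 2) :=
  summable_neg_one_pow_mul
    ((summable_mul_one_div_sq_sub summable_poleCoeff hx).sub (summable_hsum_div_mul hx))

lemma poleSeries_term {x p a t e h ε b G c : ℝ} (hp : p ≠ 0) (hG : (p ^ 2 - x) * G = 1)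
    (ha : a = 1 / (2 * p ^ 2) * (1 + ε / 2)) (ht : t = h / p)
    (hb : p ^ 2 * b = - e + h / (4 * p) - 1 / (2 * p ^ 2) + c) :
    1 / 2 * (t * G) - x * (a * (t * G) + ε * G * b + ε * t * G ^ 2)
      = (t * a + ε * b) + ε * ((e + h / (2 * p) - c + 1 / (2 * p ^ 2)) * G - p * h * G ^ 2) := by
  have hx : x * G = p ^ 2 * G - 1 := by linear_combination -hG
  have h1 : 1 / 2 * (t * G) - x * (a * (t * G) + ε * G * b + ε * t * G ^ 2)
      = 1 / 2 * (t * G) - (x * G) * (a * t + ε * b + ε * t * G) := by ring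
  rw [h1, hx, ha, ht]
  have h2 : e = h / (4 * p) - 1 / (2 * p ^ 2) + c - p ^ 2 * b := by linear_combination hb
  rw [h2]
  field_simp
  ring

/-- The product `cscSeries * harmonicSeries / 2` and its partial fraction series differ by a
constant. -/
lemma exists_cscSeries_mul_harmonicSeries : ∃ c : ℝ, ∀ x < 1,
    cscSeries x * harmonicSeries x / 2 = c + poleSeries x := by
  set b : ℕ → ℝ := fun n =>
    ∑' k : ℕ, hsum k / (k + 1) * (1 / (((k : ℝ) + 1) ^ 2 - (n + 1) ^ 2)) with hb
  have hbs : Summable b := by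
    refine ((summable_hsum_div_div.mul_left (3 / 4)).sub summable_poleCoeff).congr fun n => ?_
    have h := tsum_hsum_mul_one_div_sq_sub_sq n
    have hp : (n : ℝ) + 1 ≠ 0 := by positivity
    rw [eq_comm, ← mul_right_inj' (pow_ne_zero 2 hp), h, poleCoeff]
    field_simp
    ring
  have hb2 : Summable fun n : ℕ => b n / ((n : ℝ) + 1) ^ 2 := by
    refine hbs.norm.of_norm_bounded fun n => ?_
    rw [norm_div]
    refine div_le_self (norm_nonneg _) ?_
    rw [Real.norm_of_nonneg (by positivity)]
    nlinarith [n.cast_nonneg (α := ℝ)]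
  refine ⟨∑' n : ℕ, (hsum n / (n + 1) * (1 / (2 * ((n : ℝ) + 1) ^ 2) * (1 + (-1) ^ (n + 1) / 2))
    + (-1) ^ (n + 1) * b n), fun x hx => ?_⟩
  have ht : Summable fun k : ℕ => hsum k / ((k : ℝ) + 1) / (k + 1) :=
    summable_hsum.congr fun k => by rw [div_div, sq]
  have h := tsum_mul_tsum_one_div_sq_sub hx (t := fun k => hsum k / (k + 1))
    (fun k => div_nonneg (hsum_nonneg k) (by positivity)) ht
  simp only [tsum_alternating_one_div_sq_sub_sq] at h
  have sT := summable_mul_one_div_sq_sub summable_hsum_div_div hx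
  have s1 : Summable fun k : ℕ => 1 / (2 * ((k : ℝ) + 1) ^ 2) * (1 + (-1) ^ (k + 1) / 2)
      * (hsum k / (k + 1) * (1 / (((k : ℝ) + 1) ^ 2 - x))) := by
    refine sT.norm.of_norm_bounded fun k => ?_
    rw [norm_mul]
    refine mul_le_of_le_one_left (norm_nonneg _) ?_
    rw [norm_mul, Real.norm_of_nonneg (by positivity)]
    have h1 : ‖(1 : ℝ) + (-1) ^ (k + 1) / 2‖ ≤ 2 := by
      refine (norm_add_le _ _).trans ?_
      rw [norm_div, norm_pow]
      norm_num
    have h2 : 1 / (2 * ((k : ℝ) + 1) ^ 2) ≤ 1 / 2 := by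
      gcongr
      nlinarith [k.cast_nonneg (α := ℝ)]
    calc _ ≤ (1 : ℝ) / 2 * 2 := by gcongr
      _ = 1 := by norm_num
  have s2 : Summable fun n : ℕ => (-1) ^ (n + 1) * (1 / (((n : ℝ) + 1) ^ 2 - x)) * b n :=
    (summable_neg_one_pow_mul (summable_mul_one_div_sq_sub hb2 hx)).congr fun n => by ring
  have s3 : Summable fun n : ℕ =>
      (-1) ^ (n + 1) * (hsum n / (n + 1)) * (1 / (((n : ℝ) + 1) ^ 2 - x)) ^ 2 := by
    refine (summable_neg_one_pow_mul (summable_hsum_div_mul hx)).norm.of_norm_bounded fun n => ?_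
    rw [mul_assoc, abs_neg_one_pow_mul, abs_neg_one_pow_mul, norm_mul, norm_mul]
    refine mul_le_mul_of_nonneg_right ?_ (norm_nonneg _)
    have h0 := hsum_nonneg n
    rw [Real.norm_of_nonneg (by positivity), Real.norm_of_nonneg (by positivity), mul_comm]
    exact (div_le_self h0 (by linarith [n.cast_nonneg (α := ℝ)])).trans
      (le_mul_of_one_le_right h0 (by linarith [n.cast_nonneg (α := ℝ)]))
  have key : ∀ n : ℕ, 1 / 2 * (hsum n / (n + 1) * (1 / (((n : ℝ) + 1) ^ 2 - x)))
      - x * (1 / (2 * ((n : ℝ) + 1) ^ 2) * (1 + (-1) ^ (n + 1) / 2)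
        * (hsum n / (n + 1) * (1 / (((n : ℝ) + 1) ^ 2 - x)))
        + (-1) ^ (n + 1) * (1 / (((n : ℝ) + 1) ^ 2 - x)) * b n
        + (-1) ^ (n + 1) * (hsum n / (n + 1)) * (1 / (((n : ℝ) + 1) ^ 2 - x)) ^ 2)
      = (hsum n / (n + 1) * (1 / (2 * ((n : ℝ) + 1) ^ 2) * (1 + (-1) ^ (n + 1) / 2))
        + (-1) ^ (n + 1) * b n)
        + (-1) ^ (n + 1) * (poleCoeff n * (1 / (((n : ℝ) + 1) ^ 2 - x))
          - (n + 1) * hsum n * (1 / (((n : ℝ) + 1) ^ 2 - x)) ^ 2) := fun n =>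
    poleSeries_term (by positivity) (mul_one_div_cancel (sq_sub_pos hx n).ne') rfl rfl
      (tsum_hsum_mul_one_div_sq_sub_sq n)
  have sF := (sT.mul_left (1 / 2)).sub (((s1.add s2).add s3).mul_left x)
  have sP := summable_poleSeries hx
  have sC := ((sF.congr key).sub sP).congr fun n => add_sub_cancel_right _ _
  rw [poleSeries, ← sC.tsum_add sP, ← tsum_congr key, (sT.mul_left (1 / 2)).tsum_sub
    (((s1.add s2).add s3).mul_left x), tsum_mul_left, tsum_mul_left, (s1.add s2).tsum_add s3,
    s1.tsum_add s2, ← h, cscSeries, harmonicSeries]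
  ring

lemma tendsto_one_div_sq_sub_neg (n : ℕ) :
    Tendsto (fun N : ℕ => 1 / (((n : ℝ) + 1) ^ 2 - (-(N : ℝ)))) atTop (𝓝 0) := by
  simp only [one_div, sub_neg_eq_add]
  exact tendsto_inv_atTop_zero.comp
    (tendsto_atTop_add_const_left _ _ tendsto_natCast_atTop_atTop)

lemma one_div_sq_sub_neg_le (n N : ℕ) :
    1 / (((n : ℝ) + 1) ^ 2 - (-(N : ℝ))) ≤ 1 / ((n : ℝ) + 1) ^ 2 := by
  gcongr
  linarith [N.cast_nonneg (α := ℝ)]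

lemma one_div_sq_sub_neg_nonneg (n N : ℕ) :
    0 ≤ 1 / (((n : ℝ) + 1) ^ 2 - (-(N : ℝ))) := by
  rw [sub_neg_eq_add]
  positivity

lemma neg_natCast_lt_one (N : ℕ) : (-(N : ℝ)) < 1 := by linarith [N.cast_nonneg (α := ℝ)]

lemma tendsto_harmonicSeries : Tendsto (fun N : ℕ => harmonicSeries (-(N : ℝ))) atTop (𝓝 0) := by
  rw [← tsum_zero (β := ℕ) (α := ℝ)]
  refine tendsto_tsum_of_dominated_convergence summable_hsum_div_div
    (fun n => by simpa using (tendsto_one_div_sq_sub_neg n).const_mul (hsum n / (n + 1)))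
    (Eventually.of_forall fun N n => ?_)
  have h := div_nonneg (hsum_nonneg n) (by positivity : (0 : ℝ) ≤ n + 1)
  rw [norm_mul, Real.norm_of_nonneg h, Real.norm_of_nonneg (one_div_sq_sub_neg_nonneg n N),
    div_eq_mul_one_div _ (((n : ℝ) + 1) ^ 2)]
  exact mul_le_mul_of_nonneg_left (one_div_sq_sub_neg_le n N) h

lemma tendsto_poleSeries : Tendsto (fun N : ℕ => poleSeries (-(N : ℝ))) atTop (𝓝 0) := by
  rw [← tsum_zero (β := ℕ) (α := ℝ)]
  refine tendsto_tsum_of_dominated_convergence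
    (summable_poleCoeff.norm.add summable_hsum_div_div) (fun n => ?_)
    (Eventually.of_forall fun N n => ?_)
  · have h := tendsto_one_div_sq_sub_neg n
    simpa using ((h.const_mul (poleCoeff n)).sub
      ((h.pow 2).const_mul ((n + 1) * hsum n))).const_mul ((-1) ^ (n + 1))
  · have h := hsum_nonneg n
    have h0 := one_div_sq_sub_neg_nonneg n N
    have h1 := one_div_sq_sub_neg_le n N
    rw [abs_neg_one_pow_mul]
    refine (norm_sub_le _ _).trans (add_le_add ?_ ?_)
    · rw [norm_mul, Real.norm_of_nonneg h0, div_eq_mul_one_div (poleCoeff n), norm_mul,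
        Real.norm_of_nonneg (r := 1 / ((n : ℝ) + 1) ^ 2) (by positivity)]
      exact mul_le_mul_of_nonneg_left h1 (norm_nonneg _)
    · rw [Real.norm_of_nonneg (by positivity)]
      calc (n + 1) * hsum n * (1 / (((n : ℝ) + 1) ^ 2 - (-(N : ℝ)))) ^ 2
          ≤ (n + 1) * hsum n * (1 / ((n : ℝ) + 1) ^ 2) ^ 2 :=
            mul_le_mul_of_nonneg_left (pow_le_pow_left₀ h0 h1 2) (by positivity)
        _ = _ := by field_simp

lemma abs_cscSeries_neg_natCast_le (N : ℕ) : |cscSeries (-(N : ℝ))| ≤ 3 := by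
  have hs : Summable fun n : ℕ => 1 / (((n : ℝ) + 1) ^ 2 - (-(N : ℝ))) :=
    summable_one_div_sq.of_nonneg_of_le (fun n => one_div_sq_sub_neg_nonneg n N)
      fun n => one_div_sq_sub_neg_le n N
  have ha : Antitone fun n : ℕ => 1 / (((n : ℝ) + 1) ^ 2 - (-(N : ℝ))) := fun m n h => by
    dsimp only
    rw [sub_neg_eq_add, sub_neg_eq_add]
    gcongr
  have h := alternating_series_error_bound _ ha hs 0
  have h2 : cscSeries (-(N : ℝ))
      = 1 - 2 * (N * ∑' n : ℕ, (-1) ^ n * (1 / (((n : ℝ) + 1) ^ 2 - (-(N : ℝ))))) := by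
    rw [cscSeries]
    simp only [pow_succ, mul_neg, mul_one, neg_mul, tsum_neg]
    ring
  simp only [range_zero, sum_empty, sub_zero] at h
  have h3 : |(N : ℝ) * ∑' n : ℕ, (-1) ^ n * (1 / (((n : ℝ) + 1) ^ 2 - (-(N : ℝ))))| ≤ 1 := by
    rw [abs_mul, abs_of_nonneg N.cast_nonneg]
    refine (mul_le_mul_of_nonneg_left h N.cast_nonneg).trans ?_
    rw [mul_one_div, div_le_one (by simp; positivity)]
    simp
  rw [h2]
  rw [abs_le] at h3 ⊢
  constructor <;> linarith

theorem cscSeries_mul_harmonicSeries {x : ℝ} (hx : x < 1) :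
    cscSeries x * harmonicSeries x / 2 = poleSeries x := by
  obtain ⟨c, hc⟩ := exists_cscSeries_mul_harmonicSeries
  have h1 : Tendsto (fun N : ℕ => cscSeries (-(N : ℝ)) * harmonicSeries (-(N : ℝ)) / 2)
      atTop (𝓝 0) := by
    refine squeeze_zero_norm (fun N => ?_) (by simpa using tendsto_harmonicSeries.norm.const_mul 3)
    rw [norm_div, norm_mul, Real.norm_ofNat]
    refine (div_le_self (by positivity) (by norm_num)).trans ?_
    exact mul_le_mul_of_nonneg_right (abs_cscSeries_neg_natCast_le N) (norm_nonneg _)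
  have h2 := tendsto_poleSeries.const_add c
  simp only [hc _ (neg_natCast_lt_one _)] at h1
  rw [hc x hx, show c = 0 by simpa using tendsto_nhds_unique h2 h1, zero_add]

lemma tsum_neg_one_pow_succ_mul {f : ℕ → ℝ} (hf : Summable f) :
    ∑' n : ℕ, (-1) ^ (n + 1) * f n = 2 * ∑' n : ℕ, f (2 * n + 1) - ∑' n : ℕ, f n := by
  have he : Summable fun n : ℕ => f (2 * n) :=
    hf.comp_injective (mul_right_injective₀ two_ne_zero)
  have ho : Summable fun n : ℕ => f (2 * n + 1) :=
    hf.comp_injective fun a b h => by simpa using h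
  have h1 : ∀ n : ℕ, (-1 : ℝ) ^ (2 * n + 1) * f (2 * n) = - f (2 * n) := fun n => by
    simp [pow_succ, pow_mul]
  have h2 : ∀ n : ℕ, (-1 : ℝ) ^ (2 * n + 1 + 1) * f (2 * n + 1) = f (2 * n + 1) := fun n => by
    simp [pow_succ, pow_mul]
  have h3 := tsum_even_add_odd (f := fun n : ℕ => (-1) ^ (n + 1) * f n)
    (he.neg.congr fun n => (h1 n).symm) (ho.congr fun n => (h2 n).symm)
  rw [← h3, ← tsum_even_add_odd he ho]
  simp only [h1, h2, tsum_neg]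
  ring

lemma pi_mul_cot_eq {s : ℝ} (hs : |s| < 1) (hs0 : s ≠ 0) :
    π * Real.cot (π * s) = 1 / s - 2 * s * ∑' n : ℕ, 1 / (((n : ℝ) + 1) ^ 2 - s ^ 2) := by
  have hz : (s : ℂ) ∈ Complex.integerComplement := by
    rintro ⟨n, hn⟩
    have hn' : (n : ℝ) = s := by exact_mod_cast hn
    rw [← hn', ← Int.cast_abs] at hs
    have h1 : |n| < 1 := by exact_mod_cast hs
    rw [Int.abs_lt_one_iff] at h1
    simp [h1] at hn'
    exact hs0 hn'.symm
  have h := cot_series_rep' hz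
  rw [sub_eq_iff_eq_add'] at h
  rw [← tsum_mul_left, sub_eq_add_neg, ← tsum_neg]
  apply Complex.ofReal_injective
  push_cast
  rw [h]
  congr 1
  refine tsum_congr fun n => ?_
  have h2 := sq_sub_pos ((sq_lt_one_iff_abs_lt_one s).2 hs) n
  obtain ⟨hs1, hs2⟩ := abs_lt.1 hs
  have h3 : s - ((n : ℝ) + 1) ≠ 0 := by linarith [n.cast_nonneg (α := ℝ)]
  have h4 : s + ((n : ℝ) + 1) ≠ 0 := by linarith [n.cast_nonneg (α := ℝ)]
  have h5 : 1 / (s - ((n : ℝ) + 1)) + 1 / (s + ((n : ℝ) + 1))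
      = - (2 * s * (1 / (((n : ℝ) + 1) ^ 2 - s ^ 2))) := by
    field_simp
    ring
  have h6 := congrArg Complex.ofReal h5
  push_cast at h6
  exact h6

theorem pi_mul_inv_sin_eq {s : ℝ} (hs : |s| < 1) (hs0 : s ≠ 0) :
    π * (Real.sin (π * s))⁻¹ = cscSeries (s ^ 2) / s := by
  have hx := (sq_lt_one_iff_abs_lt_one s).2 hs
  have hs2 : |s / 2| < 1 := by
    rw [abs_div, abs_two]
    linarith [abs_nonneg s]
  have hS : Summable fun n : ℕ => 1 / (((n : ℝ) + 1) ^ 2 - s ^ 2) := by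
    simpa using summable_mul_one_div_sq_sub (c := fun _ => 1) summable_one_div_sq hx
  have h1 := pi_mul_cot_eq hs hs0
  have h2 := pi_mul_cot_eq hs2 (div_ne_zero hs0 two_ne_zero)
  have h3 : ∑' n : ℕ, 1 / (((n : ℝ) + 1) ^ 2 - (s / 2) ^ 2)
      = 4 * ∑' n : ℕ, 1 / ((((2 * n + 1 : ℕ) : ℝ) + 1) ^ 2 - s ^ 2) := by
    rw [← tsum_mul_left]
    refine tsum_congr fun n => ?_
    rw [mul_one_div, show (((2 * n + 1 : ℕ) : ℝ) + 1) ^ 2 - s ^ 2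
      = 4 * (((n : ℝ) + 1) ^ 2 - (s / 2) ^ 2) by push_cast; ring, div_mul_eq_div_div,
      div_self four_ne_zero]
  have hsin : Real.sin (π * (s / 2)) ≠ 0 := fun h => by
    obtain ⟨n, hn⟩ := Real.sin_eq_zero_iff.1 h
    have hn' : (n : ℝ) = s / 2 := by
      have := Real.pi_pos.ne'
      field_simp at hn ⊢
      linarith
    rw [← hn', ← Int.cast_abs] at hs2
    have h1 : |n| < 1 := by exact_mod_cast hs2
    rw [Int.abs_lt_one_iff] at h1
    rw [h1, Int.cast_zero] at hn'
    exact hs0 (by linarith)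
  have hcos : Real.cos (π * (s / 2)) ≠ 0 := fun h => by
    obtain ⟨n, hn⟩ := Real.cos_eq_zero_iff.1 h
    have hn' : ((2 * n + 1 : ℤ) : ℝ) = s := by
      have := Real.pi_pos.ne'
      field_simp at hn
      push_cast
      linarith
    rw [← hn', ← Int.cast_abs] at hs
    have h1 : |2 * n + 1| < 1 := by exact_mod_cast hs
    rw [Int.abs_lt_one_iff] at h1
    lia
  have hcsc : (Real.sin (π * s))⁻¹ = Real.cot (π * (s / 2)) - Real.cot (π * s) := by
    rw [Real.cot_eq_cos_div_sin, Real.cot_eq_cos_div_sin, show π * s = 2 * (π * (s / 2)) by ring,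
      Real.sin_two_mul, Real.cos_two_mul]
    field_simp
    ring
  rw [hcsc, mul_sub, h1, h2, h3, cscSeries, tsum_neg_one_pow_succ_mul hS]
  field_simp
  ring

lemma tsum_one_div_add_one_sq : ∑' n : ℕ, 1 / ((n : ℝ) + 1) ^ 2 = π ^ 2 / 6 := by
  have h := ((hasSum_nat_add_iff' 1).2 hasSum_zeta_two).tsum_eq
  simpa using h

lemma tsum_alternating_one_div_sq :
    ∑' n : ℕ, (-1) ^ (n + 1) * (1 / ((n : ℝ) + 1) ^ 2) = - π ^ 2 / 12 := by
  rw [tsum_neg_one_pow_succ_mul summable_one_div_sq, tsum_one_div_add_one_sq]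
  have h : ∀ n : ℕ, 1 / (((2 * n + 1 : ℕ) : ℝ) + 1) ^ 2 = 1 / 4 * (1 / ((n : ℝ) + 1) ^ 2) :=
    fun n => by
      rw [show ((2 * n + 1 : ℕ) : ℝ) + 1 = 2 * ((n : ℝ) + 1) by push_cast; ring]
      field_simp
      norm_num
  simp only [h, tsum_mul_left, tsum_one_div_add_one_sq]
  ring

lemma differentiableAt_log_Gamma {x : ℝ} (hx : 0 < x) :
    DifferentiableAt ℝ (fun u : ℝ => Real.log (Real.Gamma u)) x := by
  refine (differentiableAt_Gamma ?_).log (Gamma_ne_zero ?_) <;>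
  exact fun m ↦ ne_of_gt (by linarith [m.cast_nonneg (α := ℝ)])

lemma digamma_add_one {x : ℝ} (hx : 0 < x) : digamma (x + 1) = digamma x + 1 / x := by
  rw [digamma, digamma, ← deriv_comp_add_const, one_div, ← deriv_log,
    ← deriv_add (differentiableAt_log_Gamma hx) (differentiableAt_log hx.ne')]
  apply EventuallyEq.deriv_eq
  filter_upwards [eventually_gt_nhds hx] with y hy
  simp only [Pi.add_apply]
  rw [Gamma_add_one hy.ne', log_mul hy.ne' (Gamma_pos_of_pos hy).ne', add_comm]

lemma digamma_add_natCast {x : ℝ} (hx : 0 < x) (n : ℕ) :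
    digamma (x + n) = digamma x + ∑ k ∈ range n, 1 / (x + k) := by
  induction n with
  | zero => simp
  | succ n ih =>
    rw [Nat.cast_succ, ← add_assoc, digamma_add_one (by positivity), ih, sum_range_succ, add_assoc]

lemma digamma_nat_add_one (n : ℕ) :
    digamma ((n : ℝ) + 1) = hsum n - Real.eulerMascheroniConstant := by
  have hp : (0 : ℝ) < (n : ℝ) + 1 := by positivity
  rw [digamma, deriv.log (differentiableAt_Gamma fun m ↦ by linarith [m.cast_nonneg (α := ℝ)])
    (Gamma_pos_of_pos hp).ne', Real.deriv_Gamma_nat, Gamma_nat_eq_factorial, hsum_eq_harmonic]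
  field_simp
  ring

lemma digamma_mono {x y : ℝ} (hx : 0 < x) (h : x ≤ y) : digamma x ≤ digamma y := by
  have hc : ConvexOn ℝ (Set.Ioi 0) (fun u : ℝ => Real.log (Real.Gamma u)) := convexOn_log_Gamma
  exact hc.monotoneOn_deriv (fun z hz => differentiableAt_log_Gamma hz) hx (hx.trans_le h) h

theorem digamma_one_add_add_eulerMascheroniConstant {s : ℝ} (hs : |s| < 1) :
    digamma (1 + s) + Real.eulerMascheroniConstant
      = s * ∑' j : ℕ, 1 / (((j : ℝ) + 1) * (j + 1 + s)) := by
  obtain ⟨hs1, hs2⟩ := abs_lt.1 hs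
  have h0 : 0 < 1 + s := by linarith
  have hS := ((summable_one_div_mul_add hs1).hasSum.tendsto_sum_nat.const_mul s).comp
    (tendsto_add_atTop_nat 1)
  have hpart : ∀ m : ℕ, s * ∑ j ∈ range m, 1 / (((j : ℝ) + 1) * (j + 1 + s))
      = hsum m - ∑ k ∈ range m, 1 / (1 + s + k) := fun m => by
    rw [hsum, ← sum_sub_distrib, mul_sum]
    refine sum_congr rfl fun j _ => ?_
    have h1 : (0 : ℝ) < 1 + s + j := by positivity
    have h2 : (0 : ℝ) < j + 1 + s := by linarith
    rw [show 1 + s + (j : ℝ) = j + 1 + s by ring]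
    field_simp
    ring
  have ht := tendsto_one_div_add_one
  have hl := hS.sub ht
  have hu := hS.add (ht.comp (tendsto_add_atTop_nat 1))
  rw [sub_zero] at hl
  rw [add_zero] at hu
  have hval : ∀ m : ℕ, digamma (1 + s) = digamma (1 + s + (m + 1 : ℕ))
      - ∑ k ∈ range (m + 1), 1 / (1 + s + k) := fun m => by
    rw [digamma_add_natCast h0]
    ring
  refine tendsto_nhds_unique tendsto_const_nhds
    (tendsto_of_tendsto_of_tendsto_of_le_of_le hl hu (fun m => ?_) fun m => ?_)
  · have h := digamma_mono (x := (m : ℝ) + 1) (y := 1 + s + (m + 1 : ℕ)) (by positivity)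
      (by push_cast; linarith)
    rw [digamma_nat_add_one] at h
    simp only [Function.comp_apply]
    rw [hpart, hval m, hsum_succ]
    linarith
  · have h := digamma_mono (x := 1 + s + (m + 1 : ℕ)) (y := (m + 2 : ℕ) + 1) (by positivity)
      (by push_cast; linarith)
    rw [digamma_nat_add_one, hsum_succ] at h
    simp only [Function.comp_apply]
    rw [hpart, hval m]
    linarith

/-- The common value of both sides of the depth reduction, divided by `s`, at `x = s²`. -/
noncomputable def depthSeries (x : ℝ) : ℝ :=
  ∑' n : ℕ, (-1) ^ (n + 1) * ((esum n + hsum n / (2 * (n + 1))) * (1 / (((n : ℝ) + 1) ^ 2 - x))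
    - (n + 1) * hsum n * (1 / (((n : ℝ) + 1) ^ 2 - x)) ^ 2)

lemma summable_one_div_sq_sub {x : ℝ} (hx : x < 1) :
    Summable fun n : ℕ => 1 / (((n : ℝ) + 1) ^ 2 - x) := by
  simpa using summable_mul_one_div_sq_sub (c := fun _ => 1) summable_one_div_sq hx

lemma one_div_sq_sub_eq {x : ℝ} (hx : x < 1) (n : ℕ) :
    1 / (((n : ℝ) + 1) ^ 2 - x)
      = 1 / ((n : ℝ) + 1) ^ 2 + x * (1 / ((n : ℝ) + 1) ^ 2 * (1 / (((n : ℝ) + 1) ^ 2 - x))) := by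
  have := (sq_sub_pos hx n).ne'
  field_simp
  ring

lemma summable_one_div_sq_mul {x : ℝ} (hx : x < 1) :
    Summable fun n : ℕ => 1 / ((n : ℝ) + 1) ^ 2 * (1 / (((n : ℝ) + 1) ^ 2 - x)) := by
  refine summable_mul_one_div_sq_sub (summable_one_div_sq.of_nonneg_of_le
    (fun n => by positivity) fun n => div_le_self (by positivity) ?_) hx
  nlinarith [n.cast_nonneg (α := ℝ)]

lemma tsum_one_div_sq_sub {x : ℝ} (hx : x < 1) :
    ∑' n : ℕ, 1 / (((n : ℝ) + 1) ^ 2 - x) = π ^ 2 / 6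
      + x * ∑' n : ℕ, 1 / ((n : ℝ) + 1) ^ 2 * (1 / (((n : ℝ) + 1) ^ 2 - x)) := by
  rw [tsum_congr (one_div_sq_sub_eq hx), summable_one_div_sq.tsum_add
    ((summable_one_div_sq_mul hx).mul_left x), tsum_mul_left, tsum_one_div_add_one_sq]

lemma tsum_alternating_one_div_sq_sub {x : ℝ} (hx : x < 1) :
    ∑' n : ℕ, (-1) ^ (n + 1) * (1 / (((n : ℝ) + 1) ^ 2 - x)) = - π ^ 2 / 12
      + x * ∑' n : ℕ, (-1) ^ (n + 1)
        * (1 / ((n : ℝ) + 1) ^ 2 * (1 / (((n : ℝ) + 1) ^ 2 - x))) := by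
  rw [← tsum_alternating_one_div_sq, ← tsum_mul_left,
    ← (summable_neg_one_pow_mul summable_one_div_sq).tsum_add
      ((summable_neg_one_pow_mul (summable_one_div_sq_mul hx)).mul_left x)]
  refine tsum_congr fun n => ?_
  rw [one_div_sq_sub_eq hx n, mul_add, ← one_div_sq_sub_eq hx n]
  ring

lemma tsum_hsum_succ_mul_one_div_sq_sub {x : ℝ} (hx : x < 1) :
    ∑' k : ℕ, hsum (k + 1) / (k + 1) * (1 / (((k : ℝ) + 1) ^ 2 - x)) = harmonicSeries x
      + ∑' n : ℕ, 1 / ((n : ℝ) + 1) ^ 2 * (1 / (((n : ℝ) + 1) ^ 2 - x)) := by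
  rw [harmonicSeries, ← (summable_mul_one_div_sq_sub summable_hsum_div_div hx).tsum_add
    (summable_one_div_sq_mul hx)]
  refine tsum_congr fun n => ?_
  rw [hsum_succ, add_div, add_mul, div_div, ← sq]

lemma tsum_add_tsum_one_div_mul {s : ℝ} (hs : |s| < 1) :
    (∑' k : ℕ, 1 / (((k : ℝ) + 1) * (k + 1 + -s))) + ∑' j : ℕ, 1 / (((j : ℝ) + 1) * (j + 1 + s))
      = 2 * ∑' n : ℕ, 1 / (((n : ℝ) + 1) ^ 2 - s ^ 2) := by
  obtain ⟨hs1, hs2⟩ := abs_lt.1 hs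
  rw [← (summable_one_div_mul_add (by linarith)).tsum_add (summable_one_div_mul_add hs1),
    ← tsum_mul_left]
  refine tsum_congr fun n => ?_
  have h1 : (n : ℝ) + 1 + -s ≠ 0 := by linarith [n.cast_nonneg (α := ℝ)]
  have h2 : (n : ℝ) + 1 + s ≠ 0 := by linarith [n.cast_nonneg (α := ℝ)]
  have h3 : ((n : ℝ) + 1) ^ 2 - s ^ 2 = (n + 1 + s) * (n + 1 + -s) := by ring
  rw [h3]
  field_simp
  ring

lemma depthSeries_eq {x : ℝ} (hx : x < 1) :
    depthSeries x = poleSeries x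
      + π ^ 2 / 12 * (∑' n : ℕ, (-1) ^ (n + 1) * (1 / (((n : ℝ) + 1) ^ 2 - x)))
      - 1 / 2 * ∑' n : ℕ, (-1) ^ (n + 1)
        * (1 / ((n : ℝ) + 1) ^ 2 * (1 / (((n : ℝ) + 1) ^ 2 - x))) := by
  have s1 := (summable_neg_one_pow_mul (summable_one_div_sq_sub hx)).mul_left (π ^ 2 / 12)
  have s2 := (summable_neg_one_pow_mul (summable_one_div_sq_mul hx)).mul_left (1 / 2)
  rw [poleSeries, ← tsum_mul_left, ← tsum_mul_left, ← (summable_poleSeries hx).tsum_add s1,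
    ← ((summable_poleSeries hx).add s1).tsum_sub s2, depthSeries]
  refine tsum_congr fun n => ?_
  rw [poleCoeff]
  field_simp
  ring

theorem closedForm_eq_depthSeries {s : ℝ} (hs : |s| < 1) (hs0 : s ≠ 0) :
    - 1 / (4 * s ^ 3)
        + π * (Real.sin (π * s))⁻¹ / (4 * s ^ 2)
        + π ^ 3 * (Real.sin (π * s))⁻¹ / 24
        + π * (Real.sin (π * s))⁻¹ * (digamma (1 - s) + Real.eulerMascheroniConstant) / (4 * s)
        - 1 / 4 * π * (Real.sin (π * s))⁻¹ * (digamma (1 - s) + Real.eulerMascheroniConstant)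
            * (digamma (1 + s) + Real.eulerMascheroniConstant)
        - π * (Real.sin (π * s))⁻¹ * (digamma (1 + s) + Real.eulerMascheroniConstant) / (4 * s)
      = s * depthSeries (s ^ 2) := by
  have hx := (sq_lt_one_iff_abs_lt_one s).2 hs
  have hA := digamma_one_add_add_eulerMascheroniConstant (s := -s) (by rwa [abs_neg])
  have hB := digamma_one_add_add_eulerMascheroniConstant hs
  have hmul := tsum_mul_tsum_one_div hs
  have hadd := tsum_add_tsum_one_div_mul hs
  have hU := tsum_hsum_succ_mul_one_div_sq_sub hx
  have hV := tsum_one_div_sq_sub hx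
  have hQ := tsum_alternating_one_div_sq_sub hx
  have hD := depthSeries_eq hx
  have hST := cscSeries_mul_harmonicSeries hx
  have hS : cscSeries (s ^ 2)
    = 1 - 2 * s ^ 2 * ∑' n : ℕ, (-1) ^ (n + 1) * (1 / (((n : ℝ) + 1) ^ 2 - s ^ 2)) := rfl
  have hP := pi_mul_inv_sin_eq hs hs0
  rw [hU] at hmul
  rw [hV] at hadd
  rw [← sub_eq_add_neg] at hA
  rw [hA, hB]
  generalize digamma (1 - s) = a at *
  generalize (∑' k : ℕ, 1 / (((k : ℝ) + 1) * (k + 1 + -s))) = α at *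
  generalize (∑' k : ℕ, 1 / (((k : ℝ) + 1) * (k + 1 + s))) = β at *
  generalize (∑' n : ℕ, (-1) ^ (n + 1) * (1 / (((n : ℝ) + 1) ^ 2 - s ^ 2))) = Q at *
  generalize (∑' n : ℕ, (-1) ^ (n + 1)
        * (1 / ((n : ℝ) + 1) ^ 2 * (1 / (((n : ℝ) + 1) ^ 2 - s ^ 2)))) = R at *
  generalize (∑' n : ℕ, 1 / ((n : ℝ) + 1) ^ 2 * (1 / (((n : ℝ) + 1) ^ 2 - s ^ 2))) = W at *
  generalize harmonicSeries (s ^ 2) = T at *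
  generalize cscSeries (s ^ 2) = S at *
  rw [hD, ← hST]
  have hβ : β = 2 * (π ^ 2 / 6 + s ^ 2 * W) - α := by linarith
  have e1 : - 1 / (4 * s ^ 3) + π * (Real.sin (π * s))⁻¹ / (4 * s ^ 2)
        + π ^ 3 * (Real.sin (π * s))⁻¹ / 24
        + π * (Real.sin (π * s))⁻¹ * (-s * α) / (4 * s)
        - 1 / 4 * π * (Real.sin (π * s))⁻¹ * (-s * α) * (s * β)
        - π * (Real.sin (π * s))⁻¹ * (s * β) / (4 * s)
      = - 1 / (4 * s ^ 3) + (π * (Real.sin (π * s))⁻¹) * (1 / (4 * s ^ 2) + π ^ 2 / 24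
        - (α + β) / 4 + s ^ 2 / 4 * (α * β)) := by
    generalize (Real.sin (π * s))⁻¹ = y
    field_simp
    ring
  rw [e1, hP, hmul, hadd]
  have e2 : R = (Q + π ^ 2 / 12) / s ^ 2 := by
    field_simp
    linarith
  have e3 : Q = (1 - S) / (2 * s ^ 2) := by
    field_simp
    linarith
  rw [e2, e3]
  field_simp
  ring

lemma tsum_sigma_neg_one_pow_mul {κ : ℕ → Type*} [∀ n, Fintype (κ n)] {a : (Σ n, κ n) → ℝ}
    (ha : ∀ p, 0 ≤ a p) (h : Summable fun n => ∑ k, a ⟨n, k⟩) :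
    ∑' p : Σ n, κ n, (-1) ^ (p.1 + 1) * a p = ∑' n : ℕ, (-1) ^ (n + 1) * ∑ k, a ⟨n, k⟩ := by
  have hs : Summable a := (summable_sigma_of_nonneg ha).2
    ⟨fun n => (hasSum_fintype _).summable, by simpa only [tsum_fintype] using h⟩
  have hs' : Summable fun p : Σ n, κ n => (-1) ^ (p.1 + 1) * a p :=
    hs.norm.of_norm_bounded fun p => (abs_neg_one_pow_mul _ _).le
  rw [hs'.tsum_sigma]
  simp only [tsum_fintype, mul_sum]

lemma summable_div_pow {c : ℕ → ℝ} (hc : ∀ n, 0 ≤ c n)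
    (h : Summable fun n : ℕ => c n / ((n : ℝ) + 1) ^ 2) (N : ℕ) :
    Summable fun n : ℕ => c n / ((n : ℝ) + 1) ^ (N + 2) := by
  refine h.of_nonneg_of_le (fun n => div_nonneg (hc n) (by positivity)) fun n => ?_
  have := hc n
  gcongr
  · linarith [n.cast_nonneg (α := ℝ)]
  · lia

/-- Strictly increasing pairs of positive integers. -/
noncomputable def sigmaEquivPair :
    (Σ n : ℕ, Fin n) ≃ {f : Fin 2 → ℕ // StrictMono f ∧ 0 < f 0} :=
  Equiv.ofBijective
    (fun p => ⟨![p.2 + 1, p.1 + 1], by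
      rw [Fin.strictMono_iff_lt_succ]
      simp⟩) <| by
    constructor
    · rintro ⟨n, k⟩ ⟨n', k'⟩ h
      have h0 := congrFun (congrArg Subtype.val h) 0
      have h1 := congrFun (congrArg Subtype.val h) 1
      simp only [Matrix.cons_val_zero, Matrix.cons_val_one, add_left_inj] at h0 h1
      subst h1
      rw [Fin.ext h0]
    · rintro ⟨f, hf, h0⟩
      have h1 : f 0 < f 1 := hf (by decide)
      refine ⟨⟨f 1 - 1, ⟨f 0 - 1, by lia⟩⟩, Subtype.ext (funext fun i => ?_)⟩
      fin_cases i <;> simp <;> lia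

lemma sigmaEquivPair_coe (p : Σ n : ℕ, Fin n) :
    (sigmaEquivPair p : Fin 2 → ℕ) = ![(p.2 : ℕ) + 1, p.1 + 1] := rfl

/-- Strictly increasing triples of positive integers. -/
noncomputable def sigmaEquivTriple :
    (Σ n : ℕ, Σ k : Fin n, Fin k) ≃ {f : Fin 3 → ℕ // StrictMono f ∧ 0 < f 0} :=
  Equiv.ofBijective
    (fun p => ⟨![p.2.2 + 1, p.2.1 + 1, p.1 + 1], by
      rw [Fin.strictMono_iff_lt_succ, Fin.forall_fin_two]
      simp⟩) <| by
    constructor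
    · rintro ⟨n, k, j⟩ ⟨n', k', j'⟩ h
      have h0 := congrFun (congrArg Subtype.val h) 0
      have h1 := congrFun (congrArg Subtype.val h) 1
      have h2 := congrFun (congrArg Subtype.val h) 2
      simp at h0 h1 h2
      subst h2
      obtain rfl := Fin.ext h1
      rw [Fin.ext h0]
    · rintro ⟨f, hf, h0⟩
      have h1 : f 0 < f 1 := hf (by decide)
      have h2 : f 1 < f 2 := hf (by decide)
      refine ⟨⟨f 2 - 1, ⟨f 1 - 1, by lia⟩, ⟨f 0 - 1, by simp; lia⟩⟩,
        Subtype.ext (funext fun i => ?_)⟩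
      fin_cases i <;> simp <;> lia

lemma sigmaEquivTriple_coe (p : Σ n : ℕ, Σ k : Fin n, Fin k) :
    (sigmaEquivTriple p : Fin 3 → ℕ) = ![(p.2.2 : ℕ) + 1, (p.2.1 : ℕ) + 1, p.1 + 1] := rfl

lemma azeta_one_eq (N : ℕ) :
    azeta 1 (N + 1) = ∑' n : ℕ, (-1) ^ (n + 1) * (hsum n / ((n : ℝ) + 1) ^ (N + 2)) := by
  have hsum_fin : ∀ n : ℕ, ∑ k : Fin n, 1 / ((((k : ℕ) : ℝ) + 1) * ((n : ℝ) + 1) ^ (N + 2))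
      = hsum n / ((n : ℝ) + 1) ^ (N + 2) := fun n => by
    simp only [← div_div, hsum, sum_div]
    exact Fin.sum_univ_eq_sum_range (fun k => 1 / ((k : ℝ) + 1) / ((n : ℝ) + 1) ^ (N + 2)) n
  have h := tsum_sigma_neg_one_pow_mul (κ := Fin)
    (a := fun p => 1 / ((((p.2 : ℕ) : ℝ) + 1) * ((p.1 : ℝ) + 1) ^ (N + 2)))
    (fun p => by positivity)
    (by simpa only [hsum_fin] using summable_div_pow hsum_nonneg summable_hsum N)
  simp only [hsum_fin] at h
  rw [← h, azeta, ← sigmaEquivPair.tsum_eq]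
  refine tsum_congr fun p => ?_
  simp [sigmaEquivPair_coe, div_eq_mul_inv]

lemma azeta_two_eq (N : ℕ) :
    azeta 2 (N + 1) = ∑' n : ℕ, (-1) ^ (n + 1) * (esum n / ((n : ℝ) + 1) ^ (N + 2)) := by
  have esum_fin : ∀ n : ℕ, ∑ q : (Σ k : Fin n, Fin k),
      1 / ((((q.2 : ℕ) : ℝ) + 1) * (((q.1 : ℕ) : ℝ) + 1) * ((n : ℝ) + 1) ^ (N + 2))
      = esum n / ((n : ℝ) + 1) ^ (N + 2) := fun n => by
    simp only [← div_div, esum, Fintype.sum_sigma, ← sum_div]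
    congr 1
    rw [← Fin.sum_univ_eq_sum_range (fun k => hsum k / ((k : ℝ) + 1)) n]
    refine sum_congr rfl fun k _ => ?_
    rw [hsum, ← Fin.sum_univ_eq_sum_range (fun k => 1 / ((k : ℝ) + 1))]
  have h := tsum_sigma_neg_one_pow_mul (κ := fun n => Σ k : Fin n, Fin k)
    (a := fun p =>
      1 / ((((p.2.2 : ℕ) : ℝ) + 1) * (((p.2.1 : ℕ) : ℝ) + 1) * ((p.1 : ℝ) + 1) ^ (N + 2)))
    (fun p => by positivity)
    (by simpa only [esum_fin] using summable_div_pow esum_nonneg summable_esum N)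
  simp only [esum_fin] at h
  rw [← h, azeta, ← sigmaEquivTriple.tsum_eq]
  refine tsum_congr fun p => ?_
  simp [sigmaEquivTriple_coe, div_eq_mul_inv, Fin.prod_univ_two]

/-- The double series obtained by expanding the depth reduction generating function. -/
noncomputable def depthTerm (s : ℝ) (m n : ℕ) : ℝ :=
  (-1) ^ (n + 1) * ((esum n / ((n : ℝ) + 1) ^ (2 * m + 2)
    - (2 * m + 1) / 2 * (hsum n / ((n : ℝ) + 1) ^ (2 * m + 3))) * s ^ (2 * m + 1))

lemma norm_depthTerm_le (s : ℝ) (m n : ℕ) :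
    ‖depthTerm s m n‖ ≤ ((m : ℝ) + 1) * |s| ^ (2 * m + 1)
      * (esum n / ((n : ℝ) + 1) ^ 2 + hsum n / ((n : ℝ) + 1) ^ 2) := by
  have he := esum_nonneg n
  have hh := hsum_nonneg n
  have hp : (1 : ℝ) ≤ (n : ℝ) + 1 := by linarith [n.cast_nonneg (α := ℝ)]
  rw [depthTerm, abs_neg_one_pow_mul, norm_mul, norm_pow, Real.norm_eq_abs s, mul_right_comm]
  refine mul_le_mul_of_nonneg_right ((norm_sub_le _ _).trans ?_) (by positivity)
  rw [Real.norm_of_nonneg (by positivity), Real.norm_of_nonneg (by positivity), mul_add]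
  have h1 : esum n / ((n : ℝ) + 1) ^ (2 * m + 2) ≤ esum n / ((n : ℝ) + 1) ^ 2 := by
    gcongr
    lia
  have h2 : hsum n / ((n : ℝ) + 1) ^ (2 * m + 3) ≤ hsum n / ((n : ℝ) + 1) ^ 2 := by
    gcongr
    lia
  refine add_le_add (h1.trans (le_mul_of_one_le_left (by positivity) ?_)) ?_
  · linarith [m.cast_nonneg (α := ℝ)]
  · gcongr
    linarith

lemma summable_depthTerm {s : ℝ} (hs : |s| < 1) :
    Summable fun p : ℕ × ℕ => depthTerm s p.1 p.2 := by
  have hx : ‖s ^ 2‖ < 1 := by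
    rw [norm_pow, Real.norm_eq_abs]
    exact pow_lt_one₀ (abs_nonneg s) hs two_ne_zero
  have hm : Summable fun m : ℕ => ((m : ℝ) + 1) * |s| ^ (2 * m + 1) := by
    refine (((hasSum_coe_mul_geometric_of_norm_lt_one hx).summable.add
      (summable_geometric_of_norm_lt_one hx)).mul_left |s|).congr fun m => ?_
    rw [← sq_abs s, pow_succ |s| (2 * m), pow_mul |s| 2 m]
    ring
  refine (hm.mul_of_nonneg (summable_esum.add summable_hsum) (fun m => by positivity)
    fun n => ?_).of_norm_bounded fun p => norm_depthTerm_le s p.1 p.2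
  exact add_nonneg (div_nonneg (esum_nonneg n) (by positivity))
    (div_nonneg (hsum_nonneg n) (by positivity))

lemma tsum_depthTerm_left {s : ℝ} (hs : |s| < 1) (n : ℕ) :
    ∑' m : ℕ, depthTerm s m n = s * ((-1) ^ (n + 1) *
      ((esum n + hsum n / (2 * (n + 1))) * (1 / (((n : ℝ) + 1) ^ 2 - s ^ 2))
        - (n + 1) * hsum n * (1 / (((n : ℝ) + 1) ^ 2 - s ^ 2)) ^ 2)) := by
  have hx := (sq_lt_one_iff_abs_lt_one s).2 hs
  have hG := (sq_sub_pos hx n).ne'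
  have hp : (1 : ℝ) ≤ (n : ℝ) + 1 := by linarith [n.cast_nonneg (α := ℝ)]
  have hr : ‖s ^ 2 / ((n : ℝ) + 1) ^ 2‖ < 1 := by
    rw [Real.norm_of_nonneg (by positivity), div_lt_one (by positivity)]
    nlinarith
  have h1 := (hasSum_geometric_of_norm_lt_one hr).mul_left
    ((-1) ^ (n + 1) * s * (esum n / ((n : ℝ) + 1) ^ 2 - hsum n / (2 * ((n : ℝ) + 1) ^ 3)))
  have h2 := (hasSum_coe_mul_geometric_of_norm_lt_one hr).mul_left
    ((-1) ^ (n + 1) * s * (hsum n / ((n : ℝ) + 1) ^ 3))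
  have h3 := (h1.sub h2).tsum_eq
  rw [tsum_congr (g := fun m : ℕ => depthTerm s m n)] at h3
  · rw [h3]
    have hr' : 1 - s ^ 2 / ((n : ℝ) + 1) ^ 2
      = (((n : ℝ) + 1) ^ 2 - s ^ 2) / ((n : ℝ) + 1) ^ 2 := by
      field_simp
    rw [hr']
    field_simp
    ring
  · intro m
    rw [depthTerm, div_pow, ← pow_mul, ← pow_mul, pow_add _ (2 * m) 2, pow_add _ (2 * m) 3,
      pow_succ s]
    field_simp
    ring

theorem tsum_azeta_eq_depthSeries {s : ℝ} (hs : |s| < 1) :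
    ∑' m : ℕ, (azeta 2 (2 * m + 1) - (2 * (m + 1) - 1 : ℝ) / 2 * azeta 1 (2 * m + 2))
      * s ^ (2 * m + 1) = s * depthSeries (s ^ 2) := by
  have h : ∀ m : ℕ, (azeta 2 (2 * m + 1) - (2 * (m + 1) - 1 : ℝ) / 2 * azeta 1 (2 * m + 2))
      * s ^ (2 * m + 1) = ∑' n : ℕ, depthTerm s m n := fun m => by
    have s1 := summable_neg_one_pow_mul (summable_div_pow esum_nonneg summable_esum (2 * m))
    have s2 := summable_neg_one_pow_mul
      (summable_div_pow hsum_nonneg summable_hsum (2 * m + 1))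
    rw [azeta_two_eq, azeta_one_eq, ← tsum_mul_left, ← s1.tsum_sub (s2.mul_left _),
      ← tsum_mul_right]
    refine tsum_congr fun n => ?_
    rw [depthTerm]
    ring
  have hs' := summable_depthTerm hs
  rw [tsum_congr h, ← Summable.tsum_comm (f := depthTerm s) hs',
    tsum_congr (tsum_depthTerm_left hs), tsum_mul_left, depthSeries]

/-- Depth reduction for `ζ(1,1,overline{2m})`: for `0 < |s| < 1`,
`∑_{m≥1} (ζ(1,1,overline{2m}) − ((2m-1)/2) ζ(1,overline{2m+1})) s^{2m-1}`
equals an explicit combination of `π csc(πs)`, digamma values and `γ`. -/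
theorem zeta_one_one_even_bar_depth_reduction (s : ℝ) (hs : |s| < 1) (hs0 : s ≠ 0) :
    ∑' m : ℕ,
        (azeta 2 (2 * m + 1) - (2 * (m + 1) - 1 : ℝ) / 2 * azeta 1 (2 * m + 2))
          * s ^ (2 * m + 1)
      = - 1 / (4 * s ^ 3)
        + π * (Real.sin (π * s))⁻¹ / (4 * s ^ 2)
        + π ^ 3 * (Real.sin (π * s))⁻¹ / 24
        + π * (Real.sin (π * s))⁻¹ * (digamma (1 - s) + Real.eulerMascheroniConstant) / (4 * s)
        - 1 / 4 * π * (Real.sin (π * s))⁻¹ * (digamma (1 - s) + Real.eulerMascheroniConstant)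
            * (digamma (1 + s) + Real.eulerMascheroniConstant)
        - π * (Real.sin (π * s))⁻¹ * (digamma (1 + s) + Real.eulerMascheroniConstant) / (4 * s) := by
  rw [closedForm_eq_depthSeries hs hs0, tsum_azeta_eq_depthSeries hs]
end
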